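/- arXiv:1308.3112 — 2 statements merged into one kernel-verified Lean document; each statement's English description precedes it below -/
import Mathlib

section
/- Let α > 0 be real and let r ≥ 1 be an integer. Then for all sufficiently large n there exists a subset S of RM(r,n) of cardinality at least 2^{(1−α)·C(n,r)} such that |d(g,h) − 2^{n−1}| ≤ 2^{n−1}/C(n,r) for all g, h ∈ S with g ≠ h. -/
open MeasureTheory ProbabilityTheory Filter Real

noncomputable section

/-- Boolean functions on `𝔽₂ⁿ`. -/
abbrev BF (n : ℕ) := (Fin n → ZMod 2) → ZMod 2

/-- Hamming distance between Boolean functions. -/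
def hdist {n : ℕ} (f g : BF n) : ℕ := Nat.card {x : Fin n → ZMod 2 | f x ≠ g x}

/-- Weight of a Boolean function. -/
def wt {n : ℕ} (g : BF n) : ℕ := Nat.card {x : Fin n → ZMod 2 | g x ≠ 0}

/-- The Reed–Muller code `RM(r,n)`: Boolean functions of degree at most `r`. -/
def RM (r n : ℕ) : Set (BF n) :=
  {g | ∃ p : MvPolynomial (Fin n) (ZMod 2),
    p.totalDegree ≤ r ∧ ∀ x, MvPolynomial.eval x p = g x}

/-- The `r`-th order nonlinearity of a Boolean function. -/
def nonlin (r : ℕ) {n : ℕ} (f : BF n) : ℕ := sInf (hdist f '' RM r n)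

/-- Extend `x ∈ 𝔽₂ⁿ` to a finitely supported sequence `(x₁,…,xₙ,0,0,…)`. -/
def extend {n : ℕ} (x : Fin n → ZMod 2) : ℕ →₀ ZMod 2 :=
  ∑ i : Fin n, Finsupp.single (i : ℕ) (x i)

theorem rm_add {k n : ℕ} {f g : BF n} (hf : f ∈ RM k n) (hg : g ∈ RM k n) :
    (fun x => f x + g x) ∈ RM k n := by
  obtain ⟨p, hp, hp'⟩ := hf
  obtain ⟨q, hq, hq'⟩ := hg
  exact ⟨p + q, (MvPolynomial.totalDegree_add p q).trans (max_le hp hq), fun x => by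
    simp [hp', hq']⟩

theorem rm_mono {k l n : ℕ} (h : k ≤ l) {f : BF n} (hf : f ∈ RM k n) : f ∈ RM l n := by
  obtain ⟨p, hp, hp'⟩ := hf
  exact ⟨p, hp.trans h, hp'⟩

theorem rm_const (k n : ℕ) (c : ZMod 2) : (fun _ => c : BF n) ∈ RM k n :=
  ⟨MvPolynomial.C c, by simp, by simp⟩

theorem rm_smul {k n : ℕ} (c : ZMod 2) {f : BF n} (hf : f ∈ RM k n) :
    (fun x => c * f x) ∈ RM k n := by
  obtain ⟨p, hp, hp'⟩ := hf
  refine ⟨MvPolynomial.C c * p, (MvPolynomial.totalDegree_mul _ _).trans (by simpa using hp),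
    fun x => by simp [hp']⟩

theorem rm_X {k n : ℕ} (i : Fin n) {f : BF n} (hf : f ∈ RM k n) :
    (fun x => x i * f x) ∈ RM (k + 1) n := by
  obtain ⟨p, hp, hp'⟩ := hf
  refine ⟨MvPolynomial.X i * p, (MvPolynomial.totalDegree_mul _ _).trans ?_,
    fun x => by simp [hp']⟩
  rw [MvPolynomial.totalDegree_X]; omega

theorem rm_sum {k n : ℕ} {ι : Type*} (s : Finset ι) (F : ι → BF n)
    (h : ∀ i ∈ s, F i ∈ RM k n) : (fun x => ∑ i ∈ s, F i x) ∈ RM k n := by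
  classical
  induction s using Finset.induction_on with
  | empty => simpa using rm_const k n 0
  | insert a s ha ih =>
    simp only [Finset.sum_insert ha]
    exact rm_add (h a (by simp)) (ih fun i hi => h i (by simp [hi]))

/-- Directional derivative. -/
def dD {n : ℕ} (a : Fin n → ZMod 2) (f : BF n) : BF n := fun x => f (x + a) + f x

theorem z2_add_self (z : ZMod 2) : z + z = 0 := CharTwo.add_self_eq_zero z

theorem dD_monomial {n : ℕ} (a : Fin n → ZMod 2) (k : ℕ) : ∀ s : Multiset (Fin n),
    Multiset.card s ≤ k + 1 →
    dD a (fun x => (s.map x).prod) ∈ RM k n := by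
  induction k with
  | zero =>
    intro s hs
    induction s using Multiset.induction_on with
    | empty => 
      have : dD a (fun x => ((0 : Multiset (Fin n)).map x).prod) = fun _ => 0 := by
        funext x; simp [dD, z2_add_self]
      rw [this]; exact rm_const _ _ _
    | cons i t _ =>
      have ht : t = 0 := by
        rw [Multiset.card_cons] at hs
        exact Multiset.card_eq_zero.1 (by omega)
      subst ht
      have : dD a (fun x => ((i ::ₘ (0 : Multiset (Fin n))).map x).prod) = fun _ => a i := by
        funext x; simp only [dD, Multiset.map_cons, Multiset.map_zero, Multiset.prod_cons,
          Multiset.prod_zero, mul_one, Pi.add_apply]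
        linear_combination z2_add_self (x i)
      rw [this]; exact rm_const _ _ _
  | succ k ih =>
    intro s hs
    induction s using Multiset.induction_on with
    | empty => 
      have : dD a (fun x => ((0 : Multiset (Fin n)).map x).prod) = fun _ => 0 := by
        funext x; simp [dD, z2_add_self]
      rw [this]; exact rm_const _ _ _
    | cons i t _ =>
      rw [Multiset.card_cons] at hs
      have h1 := ih t (by omega)
      have h2 : (fun x => (t.map x).prod : BF n) ∈ RM (k + 1) n := by
        refine ⟨(t.map MvPolynomial.X).prod, ?_, fun x => ?_⟩
        · refine (MvPolynomial.totalDegree_multiset_prod _).trans ?_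
          simp only [Multiset.map_map, Function.comp_def, MvPolynomial.totalDegree_X]
          simp; omega
        · rw [map_multiset_prod]; simp [Multiset.map_map, Function.comp_def]
      have : dD a (fun x => ((i ::ₘ t).map x).prod) = fun x =>
          (x i * dD a (fun x => (t.map x).prod) x + a i * dD a (fun x => (t.map x).prod) x)
            + a i * (t.map x).prod := by
        funext x
        simp only [dD, Multiset.map_cons, Multiset.prod_cons, Pi.add_apply]
        linear_combination - z2_add_self (a i * (t.map x).prod)
      rw [this]
      exact rm_add (rm_add (rm_X i h1) (rm_smul _ (rm_mono (by omega) h1))) (rm_smul _ h2)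

theorem dD_mem {n k : ℕ} (a : Fin n → ZMod 2) {f : BF n} (hf : f ∈ RM (k + 1) n) :
    dD a f ∈ RM k n := by
  obtain ⟨p, hp, hp'⟩ := hf
  have : dD a f = fun x => ∑ s ∈ p.support, (p.coeff s) *
      dD a (fun x => ((Finsupp.toMultiset s).map x).prod) x := by
    funext x
    have key : ∀ y, f y = ∑ s ∈ p.support, p.coeff s * ((Finsupp.toMultiset s).map y).prod := by
      intro y
      rw [← hp', MvPolynomial.eval_eq']
      refine Finset.sum_congr rfl fun s _ => ?_
      congr 1
      rw [Finsupp.toMultiset_map, Finsupp.prod_toMultiset, Finsupp.prod_mapDomain_index (by simp)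
        (by intros; rw [pow_add]), Finsupp.prod_fintype _ _ (by simp)]
    simp only [dD]
    rw [key, key, ← Finset.sum_add_distrib]
    exact Finset.sum_congr rfl fun s _ => by ring
  rw [this]
  refine rm_sum _ _ fun s hs => rm_smul _ (dD_monomial a k _ ?_)
  have := MvPolynomial.le_totalDegree hs
  rw [Finsupp.card_toMultiset]
  exact this.trans hp

theorem rm_zero {n : ℕ} {f : BF n} (hf : f ∈ RM 0 n) : ∃ c, f = fun _ => c := by
  obtain ⟨p, hp, hp'⟩ := hf
  rw [Nat.le_zero, MvPolynomial.totalDegree_eq_zero_iff_eq_C] at hp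
  refine ⟨p.coeff 0, funext fun x => ?_⟩
  rw [← hp', hp]; simp

open Classical in
/-- support size -/
def suppF {n : ℕ} (f : BF n) : Finset (Fin n → ZMod 2) := Finset.univ.filter fun x => f x ≠ 0

theorem min_dist {n : ℕ} (k : ℕ) : ∀ f : BF n, f ∈ RM k n → f ≠ 0 →
    2 ^ n ≤ 2 ^ k * (suppF f).card := by
  classical
  have hconst : ∀ c : ZMod 2, (fun _ => c : BF n) ≠ 0 → (suppF (fun _ => c : BF n)).card = 2 ^ n := by
    intro c hc
    have hc' : c ≠ 0 := fun h => hc (by subst h; rfl)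
    simp [suppF, hc', Finset.card_univ]
  induction k with
  | zero =>
    intro f hf h0
    obtain ⟨c, rfl⟩ := rm_zero hf
    rw [hconst c h0]; simp
  | succ k ih =>
    intro f hf h0
    by_cases h : ∃ a, dD a f ≠ 0
    · obtain ⟨a, ha⟩ := h
      have h1 := ih _ (dD_mem a hf) ha
      have h2 : (suppF (dD a f)).card ≤ (suppF f).card + (suppF f).card := by
        calc (suppF (dD a f)).card ≤ (suppF f ∪ (suppF f).image (fun x => x - a)).card := by
              apply Finset.card_le_card
              intro x hx
              have hx : f (x + a) + f x ≠ 0 := (Finset.mem_filter.1 hx).2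
              simp only [suppF, Finset.mem_filter, Finset.mem_univ, true_and, Finset.mem_union,
                Finset.mem_image]
              by_contra! hcon
              apply hx
              rw [hcon.1, add_zero]
              by_contra h3
              exact hcon.2 _ h3 (by simp)
          _ ≤ _ := (Finset.card_union_le _ _).trans (Nat.add_le_add_left Finset.card_image_le _)
      calc 2 ^ n ≤ 2 ^ k * (suppF (dD a f)).card := h1
        _ ≤ 2 ^ k * ((suppF f).card + (suppF f).card) := by gcongr
        _ = _ := by ring
    · push Not at h
      have hc : f = fun _ => f 0 := by
        funext x
        have := congrFun (h x) 0
        simp only [dD, zero_add, Pi.zero_apply] at this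
        linear_combination this - z2_add_self (f 0)
      rw [hc, hconst _ (hc ▸ h0)]
      exact Nat.le_mul_of_pos_left _ (by positivity)

open Classical in
def rmf (k n : ℕ) : Finset (BF n) := Finset.univ.filter fun f => f ∈ RM k n

theorem mem_rmf {k n : ℕ} {f : BF n} : f ∈ rmf k n ↔ f ∈ RM k n := by simp [rmf]

theorem inv_span {n : ℕ} (f : BF n) (h : ∀ i, dD (Pi.single i 1) f = 0) : f = fun _ => f 0 := by
  classical
  have key : ∀ s : Finset (Fin n), f (∑ i ∈ s, Pi.single i 1) = f 0 := by
    intro s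
    induction s using Finset.induction_on with
    | empty => simp
    | insert i s hi ih =>
      rw [Finset.sum_insert hi, add_comm]
      have := congrFun (h i) (∑ i ∈ s, Pi.single i 1)
      simp only [dD, Pi.zero_apply] at this
      rw [ih] at this
      linear_combination this - z2_add_self (f 0)
  funext x
  rw [← key (Finset.univ.filter fun i => x i ≠ 0)]
  congr 1
  funext j
  rw [Finset.sum_apply]
  simp only [Pi.single_apply]
  rw [Finset.sum_ite_eq]
  have : ∀ z : ZMod 2, z = if z ≠ 0 then 1 else 0 := by decide
  simpa using this (x j)

theorem card_rmf (k n : ℕ) : (rmf k n).card ≤ 2 ^ ((n + 1) ^ k) := by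
  classical
  induction k with
  | zero =>
    calc (rmf 0 n).card ≤ ((Finset.univ : Finset (ZMod 2)).image (fun c => (fun _ => c : BF n))).card := by
          apply Finset.card_le_card
          intro f hf
          obtain ⟨c, rfl⟩ := rm_zero (mem_rmf.1 hf)
          simp
      _ ≤ _ := Finset.card_image_le.trans (by simp [Finset.card_univ])
  | succ k ih =>
    have h1 : (rmf (k + 1) n).card ≤
        ((Finset.univ : Finset (ZMod 2)) ×ˢ (Fintype.piFinset fun _ : Fin n => rmf k n)).card := by
      refine Finset.card_le_card_of_injOn (fun f => (f 0, fun i => dD (Pi.single i 1) f)) ?_ ?_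
      · intro f hf
        have hf := mem_rmf.1 (Finset.mem_coe.1 hf)
        simp [mem_rmf, dD_mem _ hf]
      · intro f _ g _ hfg
        simp only [Prod.mk.injEq] at hfg
        have h2 := inv_span (fun x => f x + g x) (fun i => by
          have := congrFun hfg.2 i
          funext x
          have := congrFun this x
          simp only [dD, Pi.zero_apply] at this ⊢
          linear_combination this + z2_add_self (g (x + Pi.single i 1)) + z2_add_self (g x))
        funext x
        have h3 := congrFun h2 x
        simp only [hfg.1] at h3
        linear_combination h3 - z2_add_self (g x) + z2_add_self (g 0)
    refine h1.trans ?_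
    rw [Finset.card_product, Fintype.card_piFinset_const]
    simp only [Finset.card_univ, ZMod.card, Fintype.card_fin]
    calc 2 * (rmf k n).card ^ n ≤ 2 * (2 ^ ((n + 1) ^ k)) ^ n := by gcongr
      _ = 2 ^ (1 + (n + 1) ^ k * n) := by rw [pow_add, pow_mul, pow_one]
      _ ≤ _ := by
        apply Nat.pow_le_pow_right (by norm_num)
        have : 1 ≤ (n + 1) ^ k := Nat.one_le_pow _ _ (by omega)
        rw [pow_succ]; nlinarith

theorem le_card_rmf (k n : ℕ) : 2 ^ (n.choose k) ≤ (rmf k n).card := by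
  classical
  have : 2 ^ (n.choose k) = (Finset.powersetCard k (Finset.univ : Finset (Fin n))).powerset.card := by
    simp
  rw [this]
  refine Finset.card_le_card_of_injOn (fun T => fun x => ∑ S ∈ T, ∏ i ∈ S, x i) ?_ ?_
  · intro T hT
    simp only [Finset.coe_powerset, Set.mem_preimage, Set.mem_powerset_iff, Finset.coe_subset] at hT
    rw [Finset.mem_coe, mem_rmf]
    refine rm_sum T (fun S x => ∏ i ∈ S, x i) fun S hS => ?_
    have hc := (Finset.mem_powersetCard.1 (hT hS)).2
    refine ⟨∏ i ∈ S, MvPolynomial.X i, ?_, fun x => by simp [map_prod]⟩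
    refine (MvPolynomial.totalDegree_finsetProd _ _).trans ?_
    simp [MvPolynomial.totalDegree_X, hc]
  · have key : ∀ T ⊆ Finset.powersetCard k (Finset.univ : Finset (Fin n)), ∀ U : Finset (Fin n),
        U.card = k → ∑ S ∈ T, ∏ i ∈ S, (if i ∈ U then (1 : ZMod 2) else 0) = if U ∈ T then 1 else 0 := by
      intro T hT U hU
      rw [← Finset.sum_ite_eq T U (fun _ => (1 : ZMod 2))]
      refine Finset.sum_congr rfl fun S hS => ?_
      have hc := (Finset.mem_powersetCard.1 (hT hS)).2
      rw [Finset.prod_ite_zero]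
      simp only [Finset.prod_const_one]
      congr 1
      apply propext
      constructor
      · intro h
        exact (Finset.eq_of_subset_of_card_le h (by omega)).symm
      · rintro rfl i hi; exact hi
    intro T hT T' hT' h
    simp only [Finset.coe_powerset, Set.mem_preimage, Set.mem_powerset_iff, Finset.coe_subset] at hT hT'
    ext U
    by_cases hU : U.card = k
    · have h1 := congrFun h (fun i => if i ∈ U then 1 else 0)
      simp only [] at h1
      rw [key T hT U hU, key T' hT' U hU] at h1
      by_cases a : U ∈ T <;> by_cases b : U ∈ T' <;> simp_all
    · exact ⟨fun h => absurd (Finset.mem_powersetCard.1 (hT h)).2 hU,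
        fun h => absurd (Finset.mem_powersetCard.1 (hT' h)).2 hU⟩

/-- The additive character. -/
def chi (z : ZMod 2) : ℝ := if z = 0 then 1 else -1

theorem chi_add (a b : ZMod 2) : chi (a + b) = chi a * chi b := by
  have h : ∀ z : ZMod 2, z = 0 ∨ z = 1 := by decide
  have h2 : (1 : ZMod 2) + 1 = 0 := by decide
  rcases h a with rfl | rfl <;> rcases h b with rfl | rfl <;> simp [chi, h2]

theorem chi_sq (a : ZMod 2) : chi a ^ 2 = 1 := by
  unfold chi; split_ifs <;> norm_num

/-- Averaging over the subspace spanned by a list. -/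
def QQ {n : ℕ} : List (Fin n → ZMod 2) → ((Fin n → ZMod 2) → ℝ) → (Fin n → ZMod 2) → ℝ
  | [], F => F
  | a :: L, F => fun x => (QQ L F x + QQ L F (x + a)) / 2

def bias {n : ℕ} (f : BF n) : ℝ := (∑ x, chi (f x)) / 2 ^ n

theorem QQ_sub {n : ℕ} (L : List (Fin n → ZMod 2)) (F : (Fin n → ZMod 2) → ℝ) (c : ℝ) (x) :
    QQ L (fun y => F y - c) x = QQ L F x - c := by
  induction L generalizing x with
  | nil => rfl
  | cons a L ih => simp only [QQ, ih]; ring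

theorem QQ_sum {n : ℕ} (L : List (Fin n → ZMod 2)) (F : (Fin n → ZMod 2) → ℝ) :
    ∑ x, QQ L F x = ∑ x, F x := by
  induction L with
  | nil => rfl
  | cons a L ih =>
    simp only [QQ]
    have h : ∑ x, QQ L F (x + a) = ∑ x, QQ L F x :=
      Equiv.sum_comp (Equiv.addRight a) (fun x => QQ L F x)
    rw [← Finset.sum_div, Finset.sum_add_distrib, h, ih]
    ring

theorem QQ_inv {n : ℕ} (L : List (Fin n → ZMod 2)) (f g : BF n)
    (h : ∀ a ∈ L, dD a f = dD a g) (x) :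
    QQ L (fun y => chi (f y)) x = chi (f x + g x) * QQ L (fun y => chi (g y)) x := by
  induction L generalizing x with
  | nil =>
    simp only [QQ, chi_add]
    linear_combination - chi (f x) * chi_sq (g x)
  | cons a L ih =>
    have h1 := ih (fun b hb => h b (by simp [hb]))
    have h2 : f (x + a) + g (x + a) = f x + g x := by
      have := congrFun (h a (by simp)) x
      simp only [dD] at this
      linear_combination this + z2_add_self (g (x + a)) - z2_add_self (f x)
    simp only [QQ]
    rw [h1 x, h1 (x + a), h2]; ring

theorem card_V (n : ℕ) : (Finset.univ : Finset (Fin n → ZMod 2)).card = 2 ^ n := by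
  simp [Finset.card_univ]

theorem avg_step {n : ℕ} (G : (Fin n → ZMod 2) → ℝ) (hG : ∑ x, G x = 0) :
    ∑ a, ∑ x, ((G x + G (x + a)) / 2) ^ 2 = 2 ^ n * ((∑ x, G x ^ 2) / 2) := by
  have h1 : ∀ x, ∑ a, G (x + a) = 0 := fun x => by
    rw [← hG]; exact Equiv.sum_comp (Equiv.addLeft x) G
  have h2 : ∀ x, ∑ a, G (x + a) ^ 2 = ∑ y, G y ^ 2 := fun x =>
    Equiv.sum_comp (Equiv.addLeft x) (fun y => G y ^ 2)
  rw [Finset.sum_comm]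
  have h3 : ∀ x, ∑ a, ((G x + G (x + a)) / 2) ^ 2 =
      (2 ^ n * G x ^ 2 + ∑ y, G y ^ 2) / 4 := by
    intro x
    calc ∑ a, ((G x + G (x + a)) / 2) ^ 2
        = ∑ a, (G x ^ 2 / 4 + G x / 2 * G (x + a) + G (x + a) ^ 2 / 4) := by
          refine Finset.sum_congr rfl fun a _ => by ring
      _ = _ := by
          rw [Finset.sum_add_distrib, Finset.sum_add_distrib, ← Finset.mul_sum, h1,
            ← Finset.sum_div _ (fun a => G (x + a) ^ 2), h2, Finset.sum_const, card_V]
          simp; ring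
  simp only [h3]
  rw [← Finset.sum_div, Finset.sum_add_distrib, ← Finset.mul_sum, Finset.sum_const, card_V]
  simp; ring

theorem exists_list {n : ℕ} (B : Finset (BF n)) (m : ℕ) :
    ∃ L : List (Fin n → ZMod 2), L.length = m ∧
      ∑ p ∈ B, ∑ x, (QQ L (fun y => chi (p y)) x - bias p) ^ 2 ≤ B.card * 2 ^ n / 2 ^ m := by
  have hN : (0 : ℝ) < 2 ^ n := by positivity
  have hz : ∀ p : BF n, ∑ x, (chi (p x) - bias p) = 0 := by
    intro p
    rw [Finset.sum_sub_distrib, Finset.sum_const, card_V, bias]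
    simp; field_simp; simp
  induction m with
  | zero =>
    refine ⟨[], rfl, ?_⟩
    simp only [QQ, pow_zero, div_one]
    rw [← nsmul_eq_mul, ← Finset.sum_const]
    refine Finset.sum_le_sum fun p _ => ?_
    have h1 : ∀ x, (chi (p x) - bias p) ^ 2 = 1 - bias p ^ 2 - 2 * bias p * (chi (p x) - bias p) := by
      intro x; linear_combination chi_sq (p x)
    simp only [h1]
    rw [Finset.sum_sub_distrib, ← Finset.mul_sum, hz, Finset.sum_const, card_V]
    simp only [nsmul_eq_mul]
    push_cast
    nlinarith [sq_nonneg (bias p)]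
  | succ m ih =>
    obtain ⟨L, hL, hs⟩ := ih
    have key : ∑ a : Fin n → ZMod 2, ∑ p ∈ B, ∑ x, (QQ (a :: L) (fun y => chi (p y)) x - bias p) ^ 2
        ≤ ∑ a : Fin n → ZMod 2, (B.card * 2 ^ n / 2 ^ (m + 1) : ℝ) := by
      rw [Finset.sum_comm, Finset.sum_const, card_V]
      have h1 : ∀ p : BF n, ∑ a, ∑ x, (QQ (a :: L) (fun y => chi (p y)) x - bias p) ^ 2
          = 2 ^ n * ((∑ x, (QQ L (fun y => chi (p y)) x - bias p) ^ 2) / 2) := by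
        intro p
        rw [← avg_step (fun x => QQ L (fun y => chi (p y)) x - bias p)]
        · refine Finset.sum_congr rfl fun a _ => Finset.sum_congr rfl fun x _ => ?_
          simp only [QQ]; ring
        · simp only [← QQ_sub]
          rw [QQ_sum]; exact hz p
      simp only [h1]
      rw [← Finset.mul_sum, ← Finset.sum_div, nsmul_eq_mul]
      push_cast
      rw [pow_succ (2 : ℝ) m, ← div_div]
      gcongr
    obtain ⟨a, _, ha⟩ := Finset.exists_le_of_sum_le Finset.univ_nonempty key
    exact ⟨a :: L, by simp [hL], ha⟩

theorem pair_eq {n m r : ℕ} (L : List (Fin n → ZMod 2)) (p q : BF n) (ε : ℝ) (hε : 0 < ε)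
    (hm : (2 : ℝ) ^ (r + 1) < 2 ^ m * ε ^ 2) (hp : p ∈ RM r n) (hq : q ∈ RM r n)
    (h : ∀ a ∈ L, dD a p = dD a q)
    (hb : (2 * ε) ^ 2 ≤ (bias p + bias q) ^ 2)
    (hp2 : ∑ x, (QQ L (fun y => chi (p y)) x - bias p) ^ 2 ≤ 2 * 2 ^ n / 2 ^ m)
    (hq2 : ∑ x, (QQ L (fun y => chi (q y)) x - bias q) ^ 2 ≤ 2 * 2 ^ n / 2 ^ m) : p = q := by
  by_contra hne
  set w : BF n := fun x => p x + q x with hw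
  have hw0 : w ≠ 0 := by
    intro h0
    apply hne
    funext x
    have := congrFun h0 x
    simp only [hw, Pi.zero_apply] at this
    linear_combination this - z2_add_self (q x)
  have h1 := min_dist r w (rm_add hp hq) hw0
  have h1' : (2 : ℝ) ^ n ≤ 2 ^ r * (suppF w).card := by exact_mod_cast h1
  have h2 : ((suppF w).card : ℝ) * (2 * ε ^ 2) ≤ 2 * 2 ^ n / 2 ^ m + 2 * 2 ^ n / 2 ^ m := by
    refine le_trans ?_ (add_le_add hp2 hq2)
    rw [← Finset.sum_add_distrib, ← nsmul_eq_mul, ← Finset.sum_const]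
    refine le_trans (Finset.sum_le_sum (f := fun _ => 2 * ε ^ 2) ?_)
      (Finset.sum_le_sum_of_subset_of_nonneg (Finset.subset_univ _) fun _ _ _ => by positivity)
    intro x hx
    have hx : w x ≠ 0 := by simpa [suppF] using hx
    have h3 := QQ_inv L p q h x
    have h4 : chi (p x + q x) = -1 := by unfold chi; rw [if_neg hx]
    rw [h4] at h3
    rw [h3]
    nlinarith [sq_nonneg ((-1 * QQ L (fun y => chi (q y)) x - bias p) -
      (QQ L (fun y => chi (q y)) x - bias q))]
  have hN : (0 : ℝ) < 2 ^ n := by positivity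
  have hM : (0 : ℝ) < 2 ^ m := by positivity
  have hR : (0 : ℝ) < 2 ^ r := by positivity
  have h5 : 2 * 2 ^ n / 2 ^ m + 2 * 2 ^ n / 2 ^ m = (4 * 2 ^ n : ℝ) / 2 ^ m := by ring
  rw [h5, le_div_iff₀ hM] at h2
  have h6 : (2 : ℝ) ^ n * (2 * ε ^ 2) * 2 ^ m ≤ 2 ^ n * (4 * 2 ^ r) := by
    calc (2 : ℝ) ^ n * (2 * ε ^ 2) * 2 ^ m ≤ (2 ^ r * (suppF w).card) * (2 * ε ^ 2) * 2 ^ m := by gcongr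
      _ = 2 ^ r * ((suppF w).card * (2 * ε ^ 2) * 2 ^ m) := by ring
      _ ≤ 2 ^ r * (4 * 2 ^ n) := by gcongr
      _ = _ := by ring
  have h7 : (2 * ε ^ 2) * 2 ^ m ≤ (4 * 2 ^ r : ℝ) := by
    rw [mul_assoc] at h6
    exact le_of_mul_le_mul_left h6 hN
  rw [pow_succ] at hm
  linarith

open Classical in
def badf (r n : ℕ) (ε : ℝ) : Finset (BF n) := (rmf r n).filter fun p => ε < |bias p|

theorem card_bad (r n m : ℕ) (ε : ℝ) (hε : 0 < ε)
    (hm : (2 : ℝ) ^ (r + 1 + 1) < 2 ^ m * ε ^ 2) :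
    (badf (r + 1) n ε).card ≤ 4 * 2 ^ (m * (n + 1) ^ r) := by
  classical
  set B := badf (r + 1) n ε with hB
  obtain ⟨L, hL, hs⟩ := exists_list B m
  set V : BF n → ℝ := fun p => ∑ x, (QQ L (fun y => chi (p y)) x - bias p) ^ 2 with hV
  have hVn : ∀ p, 0 ≤ V p := fun p => Finset.sum_nonneg fun _ _ => by positivity
  set t : ℝ := 2 ^ n / 2 ^ m with ht
  have ht0 : 0 < t := by positivity
  have h1 : B.card ≤ 2 * (B.filter fun p => V p ≤ 2 * t).card := by
    have h2 : ((B.filter fun p => ¬ V p ≤ 2 * t).card : ℝ) * (2 * t) ≤ B.card * t := by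
      calc ((B.filter fun p => ¬ V p ≤ 2 * t).card : ℝ) * (2 * t)
          = ∑ p ∈ B.filter (fun p => ¬ V p ≤ 2 * t), (2 * t) := by simp
        _ ≤ ∑ p ∈ B.filter (fun p => ¬ V p ≤ 2 * t), V p :=
            Finset.sum_le_sum fun p hp => (not_le.1 (Finset.mem_filter.1 hp).2).le
        _ ≤ ∑ p ∈ B, V p := Finset.sum_le_sum_of_subset_of_nonneg (Finset.filter_subset _ _)
            fun _ _ _ => hVn _
        _ ≤ _ := by rw [ht, ← mul_div_assoc]; exact hs
    have h3 : ((B.filter fun p => ¬ V p ≤ 2 * t).card : ℝ) * 2 ≤ B.card := by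
      refine le_of_mul_le_mul_right ?_ ht0
      linarith
    have h4 : (B.filter fun p => ¬ V p ≤ 2 * t).card * 2 ≤ B.card := by exact_mod_cast h3
    have h5 := Finset.card_filter_add_card_filter_not (s := B) (fun p => V p ≤ 2 * t)
    omega
  set B' := B.filter fun p => V p ≤ 2 * t with hB'
  have hinj : ∀ C ⊆ B', (∀ p ∈ C, ∀ q ∈ C, (2 * ε) ^ 2 ≤ (bias p + bias q) ^ 2) →
      C.card ≤ 2 ^ (m * (n + 1) ^ r) := by
    intro C hC hsign
    have hmem : ∀ p ∈ C, p ∈ RM (r + 1) n ∧ V p ≤ 2 * t := by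
      intro p hp
      have h6 := Finset.mem_filter.1 (hC hp)
      exact ⟨mem_rmf.1 (Finset.mem_filter.1 h6.1).1, h6.2⟩
    have h7 : C.card ≤ (Fintype.piFinset fun _ : {a // a ∈ L.toFinset} => rmf r n).card := by
      refine Finset.card_le_card_of_injOn (fun p => fun a => dD a.1 p) ?_ ?_
      · intro p hp
        have := (hmem p hp).1
        simp [mem_rmf, dD_mem _ this]
      · intro p hp q hq hpq
        refine pair_eq L p q ε hε hm (hmem p hp).1 (hmem q hq).1 ?_ (hsign p hp q hq) ?_ ?_
        · intro a ha
          exact congrFun hpq ⟨a, by simpa using ha⟩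
        · rw [mul_div_assoc]; exact (hmem p hp).2
        · rw [mul_div_assoc]; exact (hmem q hq).2
    rw [Fintype.card_piFinset, Finset.prod_const, Finset.card_univ] at h7
    refine h7.trans ?_
    calc (rmf r n).card ^ _ ≤ (2 ^ ((n + 1) ^ r)) ^ Fintype.card {a // a ∈ L.toFinset} := by
          gcongr; exact card_rmf r n
      _ ≤ (2 ^ ((n + 1) ^ r)) ^ m := by
          apply Nat.pow_le_pow_right (by positivity)
          rw [Fintype.card_coe, ← hL]; exact L.toFinset_card_le
      _ = _ := by rw [← pow_mul, mul_comm]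
  have hbad : ∀ p ∈ B', ε < |bias p| := fun p hp =>
    (Finset.mem_filter.1 (Finset.mem_filter.1 hp).1).2
  have hpos := hinj (B'.filter fun p => 0 ≤ bias p) (Finset.filter_subset _ _) (by
    intro p hp q hq
    rw [Finset.mem_filter] at hp hq
    have a1 := hbad p hp.1
    have a2 := hbad q hq.1
    rw [abs_of_nonneg hp.2] at a1
    rw [abs_of_nonneg hq.2] at a2
    gcongr; linarith)
  have hneg := hinj (B'.filter fun p => ¬ 0 ≤ bias p) (Finset.filter_subset _ _) (by
    intro p hp q hq
    rw [Finset.mem_filter] at hp hq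
    have a1 := hbad p hp.1
    have a2 := hbad q hq.1
    rw [abs_of_neg (not_le.1 hp.2)] at a1
    rw [abs_of_neg (not_le.1 hq.2)] at a2
    rw [← neg_sq (bias p + bias q)]
    gcongr; linarith)
  have h8 := Finset.card_filter_add_card_filter_not (s := B') (fun p => 0 ≤ bias p)
  omega

theorem bias_hdist {n : ℕ} (g h : BF n) :
    bias (fun x => g x + h x) * 2 ^ n = 2 ^ n - 2 * hdist g h := by
  classical
  have h0 : ∀ a b : ZMod 2, a + b = 0 ↔ a = b := by decide
  have h1 : hdist g h = (Finset.univ.filter fun x => ¬ g x = h x).card := by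
    rw [hdist, Nat.card_eq_fintype_card, ← Set.toFinset_card]
    congr 1; ext x; simp
  rw [bias, div_mul_cancel₀ _ (by positivity), h1]
  have h2 := Finset.card_filter_add_card_filter_not (s := Finset.univ) (fun x => g x = h x)
  rw [card_V] at h2
  have h2' : ((Finset.univ.filter fun x => g x = h x).card : ℝ) +
    (Finset.univ.filter fun x => ¬ g x = h x).card = 2 ^ n := by exact_mod_cast h2
  simp only [chi, h0]
  rw [Finset.sum_ite]
  simp only [Finset.sum_const, nsmul_eq_mul]
  linarith

theorem greedy (r n K : ℕ) (ε : ℝ) (hK : (badf r n ε).card + 1 ≤ K) :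
    ∃ S : Finset (BF n), ↑S ⊆ RM r n ∧ (rmf r n).card ≤ S.card * K ∧
      ∀ g ∈ S, ∀ h ∈ S, g ≠ h → |bias (fun x => g x + h x)| ≤ ε := by
  classical
  let good : Finset (Finset (BF n)) := (rmf r n).powerset.filter fun S =>
    ∀ g ∈ S, ∀ h ∈ S, g ≠ h → |bias (fun x => g x + h x)| ≤ ε
  have hne : good.Nonempty := ⟨∅, by simp [good]⟩
  obtain ⟨S, hS, hmax⟩ := Finset.exists_max_image good Finset.card hne
  have hS' := Finset.mem_filter.1 hS
  have hsub := Finset.mem_powerset.1 hS'.1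
  refine ⟨S, fun g hg => mem_rmf.1 (hsub hg), ?_, hS'.2⟩
  have hcov : rmf r n ⊆ S.biUnion fun h => (insert 0 (badf r n ε)).image fun b => (fun x => b x + h x) := by
    intro g hg
    by_contra hcon
    simp only [Finset.mem_biUnion, Finset.mem_image, not_exists, not_and] at hcon
    have hback : ∀ h : BF n, (fun x => (g x + h x) + h x) = g := by
      intro h; funext x; linear_combination z2_add_self (h x)
    have hgS : g ∉ S := fun hgS => hcon g hgS 0 (by simp) (by funext x; simp)
    have hsmall : ∀ h ∈ S, |bias (fun x => g x + h x)| ≤ ε := by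
      intro h hh
      by_contra! hlt
      refine hcon h hh (fun x => g x + h x) (Finset.mem_insert_of_mem ?_) (hback h)
      exact Finset.mem_filter.2 ⟨mem_rmf.2 (rm_add (mem_rmf.1 hg) (mem_rmf.1 (hsub hh))), hlt⟩
    have hin : insert g S ∈ good := by
      refine Finset.mem_filter.2 ⟨Finset.mem_powerset.2 (Finset.insert_subset hg hsub), ?_⟩
      intro a ha b hb hab
      rcases Finset.mem_insert.1 ha with rfl | haS
      · rcases Finset.mem_insert.1 hb with rfl | hb
        · exact absurd rfl hab
        · exact hsmall b hb
      · rcases Finset.mem_insert.1 hb with rfl | hb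
        · have := hsmall a haS
          simpa only [add_comm] using this
        · exact hS'.2 a haS b hb hab
    have := hmax _ hin
    rw [Finset.card_insert_of_notMem hgS] at this
    omega
  refine (Finset.card_le_card hcov).trans (Finset.card_biUnion_le_card_mul _ _ _ fun h _ => ?_)
  exact Finset.card_image_le.trans ((Finset.card_insert_le _ _).trans hK)

theorem pow_le_pow_mul_choose (k : ℕ) : ∀ n, k ≤ n → n ^ k ≤ k ^ k * n.choose k := by
  induction k with
  | zero => simp
  | succ k ih =>
    intro n hn
    obtain ⟨n, rfl⟩ : ∃ j, n = j + 1 := ⟨n - 1, by omega⟩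
    have hkn : k ≤ n := by omega
    have h1 := ih n hkn
    have h2 : (n + 1) ^ k ≤ (k + 1) ^ k * n.choose k := by
      rcases Nat.eq_zero_or_pos k with rfl | hk
      · simp
      · have h3 : k ^ k * (n + 1) ^ k ≤ k ^ k * ((k + 1) ^ k * n.choose k) := by
          calc k ^ k * (n + 1) ^ k = (k * (n + 1)) ^ k := by rw [mul_pow]
            _ ≤ ((k + 1) * n) ^ k := by gcongr ?_ ^ k; nlinarith
            _ = (k + 1) ^ k * n ^ k := by rw [mul_pow]
            _ ≤ (k + 1) ^ k * (k ^ k * n.choose k) := by gcongr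
            _ = _ := by ring
        exact Nat.le_of_mul_le_mul_left h3 (by positivity)
    calc (n + 1) ^ (k + 1) = (n + 1) * (n + 1) ^ k := by ring
      _ ≤ (n + 1) * ((k + 1) ^ k * n.choose k) := by gcongr
      _ = (k + 1) ^ k * ((n + 1) * n.choose k) := by ring
      _ = (k + 1) ^ k * ((n + 1).choose (k + 1) * (k + 1)) := by
        rw [← Nat.add_one_mul_choose_eq]
      _ = _ := by ring

theorem asym (α : ℝ) (hα : 0 < α) (r : ℕ) :
    ∀ᶠ n : ℕ in atTop, r + 1 ≤ n ∧
      (((r + 1 + 2 + 2 * ((r + 1) * (Nat.log 2 n + 1))) * (n + 1) ^ r + 3 : ℕ) : ℝ)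
        ≤ α * (n.choose (r + 1) : ℝ) := by
  set R : ℝ := (r : ℝ) + 1 with hR
  have hRpos : 0 < R := by positivity
  set A : ℝ := 2 ^ r * R ^ (r + 1) / α with hA
  have hApos : 0 < A := by positivity
  have hlog2 : 0 < Real.log 2 := Real.log_pos (by norm_num)
  have hl : ∀ᶠ n : ℕ in atTop, |Real.log n| ≤ (Real.log 2 / (4 * R * A)) * |(n : ℝ)| := by
    have := (Real.isLittleO_log_id_atTop.comp_tendsto tendsto_natCast_atTop_atTop).bound
      (c := Real.log 2 / (4 * R * A)) (by positivity)
    simpa using this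
  have hc : ∀ᶠ n : ℕ in atTop, 2 * (A * (3 * R + 5)) ≤ (n : ℝ) :=
    tendsto_natCast_atTop_atTop.eventually_ge_atTop _
  filter_upwards [hl, hc, eventually_ge_atTop (r + 1)] with n h1 h2 h3
  refine ⟨h3, ?_⟩
  have hn1 : 1 ≤ n := by omega
  have hn1' : (1 : ℝ) ≤ n := by exact_mod_cast hn1
  have hn0 : (0 : ℝ) < n := by linarith
  have h4 : (Nat.log 2 n : ℝ) * Real.log 2 ≤ Real.log n := by
    have := Real.natLog_le_logb n 2
    rw [Real.logb, le_div_iff₀ (by simpa using hlog2)] at this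
    simpa using this
  have h5 : Real.log n ≤ (Real.log 2 / (4 * R * A)) * n := by
    have := (le_abs_self _).trans h1
    rwa [abs_of_nonneg hn0.le] at this
  have h6 : 2 * R * A * (Nat.log 2 n : ℝ) ≤ n / 2 := by
    have h7 := h4.trans h5
    rw [div_mul_eq_mul_div, le_div_iff₀ (by positivity)] at h7
    have : Real.log 2 * (4 * R * A * (Nat.log 2 n : ℝ)) ≤ Real.log 2 * n := by linarith
    have := le_of_mul_le_mul_left this hlog2
    linarith
  have h8 : A * (3 * R + 5 + 2 * R * (Nat.log 2 n : ℝ)) ≤ n := by nlinarith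
  have hch : ((n : ℝ) / R) ^ (r + 1) ≤ n.choose (r + 1) := by
    rw [div_pow, div_le_iff₀' (by positivity), hR]
    exact_mod_cast pow_le_pow_mul_choose (r + 1) n h3
  calc (((r + 1 + 2 + 2 * ((r + 1) * (Nat.log 2 n + 1))) * (n + 1) ^ r + 3 : ℕ) : ℝ)
      = (R + 2 + 2 * (R * (Nat.log 2 n + 1))) * ((n : ℝ) + 1) ^ r + 3 := by push_cast; rfl
    _ ≤ (R + 2 + 2 * (R * (Nat.log 2 n + 1))) * ((n : ℝ) + 1) ^ r + 3 * ((n : ℝ) + 1) ^ r := by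
        have : (1 : ℝ) ≤ ((n : ℝ) + 1) ^ r := one_le_pow₀ (by linarith)
        linarith
    _ = (3 * R + 5 + 2 * R * (Nat.log 2 n : ℝ)) * ((n : ℝ) + 1) ^ r := by ring
    _ ≤ (3 * R + 5 + 2 * R * (Nat.log 2 n : ℝ)) * (2 * (n : ℝ)) ^ r := by
        gcongr; linarith
    _ = α * ((A * (3 * R + 5 + 2 * R * (Nat.log 2 n : ℝ))) * n ^ r / R ^ (r + 1)) := by
        rw [hA, mul_pow]; field_simp
    _ ≤ α * (n * n ^ r / R ^ (r + 1)) := by gcongr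
    _ = α * (((n : ℝ) / R) ^ (r + 1)) := by rw [div_pow]; ring
    _ ≤ _ := by gcongr

theorem stmt3 (α : ℝ) (hα : 0 < α) (r : ℕ) (hr : 1 ≤ r) :
    ∀ᶠ n : ℕ in atTop, ∃ S : Finset (BF n), ↑S ⊆ RM r n ∧
      (2:ℝ) ^ ((1 - α) * (n.choose r : ℝ)) ≤ S.card ∧
      ∀ g ∈ S, ∀ h ∈ S, g ≠ h →
        |(hdist g h : ℝ) - 2^(n-1)| ≤ 2^(n-1) / (n.choose r : ℝ) := by
  obtain ⟨r, rfl⟩ : ∃ k, r = k + 1 := ⟨r - 1, by omega⟩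
  filter_upwards [asym α hα r] with n hn
  obtain ⟨hn1, hn2⟩ := hn
  set C := n.choose (r + 1) with hC
  have hCpos : 0 < C := Nat.choose_pos hn1
  have hCpos' : (0 : ℝ) < C := by exact_mod_cast hCpos
  set m := r + 1 + 2 + 2 * ((r + 1) * (Nat.log 2 n + 1)) with hm
  have hCle : C ≤ 2 ^ ((r + 1) * (Nat.log 2 n + 1)) := by
    calc C ≤ n ^ (r + 1) := Nat.choose_le_pow n (r + 1)
      _ ≤ (2 ^ (Nat.log 2 n + 1)) ^ (r + 1) := by
        gcongr; exact (Nat.lt_pow_succ_log_self (by norm_num) n).le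
      _ = _ := by rw [← pow_mul, mul_comm]
  have hCle' : (C : ℝ) ≤ 2 ^ ((r + 1) * (Nat.log 2 n + 1)) := by exact_mod_cast hCle
  have hmε : (2 : ℝ) ^ (r + 1 + 1) < 2 ^ m * (1 / (C : ℝ)) ^ 2 := by
    rw [one_div, inv_pow, ← div_eq_mul_inv, lt_div_iff₀ (by positivity)]
    calc (2 : ℝ) ^ (r + 1 + 1) * C ^ 2 ≤ 2 ^ (r + 1 + 1) * (2 ^ ((r + 1) * (Nat.log 2 n + 1))) ^ 2 := by gcongr
      _ < 2 ^ (r + 1 + 2) * (2 ^ ((r + 1) * (Nat.log 2 n + 1))) ^ 2 := by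
        gcongr <;> norm_num
      _ = 2 ^ m := by rw [hm, ← pow_mul, ← pow_add]; ring
  have hbad := card_bad r n m (1 / (C : ℝ)) (by positivity) hmε
  obtain ⟨S, hS1, hS2, hS3⟩ := greedy (r + 1) n (2 ^ (m * (n + 1) ^ r + 3)) (1 / (C : ℝ)) (by
    have : 1 ≤ 2 ^ (m * (n + 1) ^ r) := Nat.one_le_two_pow
    rw [pow_add]; omega)
  refine ⟨S, hS1, ?_, ?_⟩
  · have h1 := (le_card_rmf (r + 1) n).trans hS2
    have h2 : (2 : ℝ) ^ C ≤ S.card * 2 ^ (m * (n + 1) ^ r + 3) := by exact_mod_cast h1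
    have hpos : (0 : ℝ) < 2 ^ (m * (n + 1) ^ r + 3) := by positivity
    rw [← div_le_iff₀ hpos] at h2
    refine le_trans ?_ h2
    rw [← Real.rpow_natCast, ← Real.rpow_natCast, ← Real.rpow_sub (by norm_num)]
    apply Real.rpow_le_rpow_of_exponent_le (by norm_num)
    linarith
  · intro g hg h hh hgh
    have h1 := hS3 g hg h hh hgh
    have h2 := bias_hdist g h
    have h3 : (2 : ℝ) ^ n = 2 * 2 ^ (n - 1) := by
      rw [← pow_succ']; congr 1; omega
    have h4 : (hdist g h : ℝ) - 2 ^ (n - 1) = - (bias (fun x => g x + h x) * 2 ^ (n - 1)) := by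
      rw [h3] at h2; linarith
    rw [h4, abs_neg, abs_mul, abs_of_pos (by positivity : (0 : ℝ) < 2 ^ (n - 1))]
    calc _ ≤ 1 / (C : ℝ) * 2 ^ (n - 1) := by gcongr
      _ = _ := by ring
end
end

section
/- Let r ≥ 1 be an integer and let α ∈ (0,1) be real. Then for all sufficiently large n the following holds: if f is a uniformly distributed random Boolean function on 𝔽₂ⁿ, then Pr[ 2ⁿ − 2·N_r(f) ≥ √(2^{n+1}·C(n,r)·log 2) ] ≥ 1 / 4^{α·C(n,r)}. -/
open MeasureTheory ProbabilityTheory Filter Real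

noncomputable section

/-- Iterated-derivative notion of degree at most `r`. -/
def DD {n : ℕ} : ℕ → BF n → Prop
  | 0, f => ∀ x y, f x = f y
  | r + 1, f => ∀ y, DD r (fun x => f (x + y) + f x)

lemma DD_const {n : ℕ} (r : ℕ) : ∀ f : BF n, (∀ x y, f x = f y) → DD r f := by
  induction r with
  | zero => intro f h; exact h
  | succ r ih =>
    intro f h y
    apply ih
    intro x z
    simp only [h (x + y) (z + y), h x z]

lemma DD_mono {n : ℕ} (r : ℕ) : ∀ f : BF n, DD r f → DD (r + 1) f := by
  induction r with
  | zero => intro f h; exact DD_const 1 f h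
  | succ r ih =>
    intro f h y
    exact ih _ (h y)

lemma DD_add {n : ℕ} (r : ℕ) : ∀ f g : BF n, DD r f → DD r g → DD r (fun x => f x + g x) := by
  induction r with
  | zero =>
    intro f g hf hg x y
    simp only [hf x y, hg x y]
  | succ r ih =>
    intro f g hf hg y
    have := ih _ _ (hf y) (hg y)
    convert this using 2
    ring

lemma DD_shift {n : ℕ} (r : ℕ) : ∀ (f : BF n) (z : Fin n → ZMod 2), DD r f →
    DD r (fun x => f (x + z)) := by
  induction r with
  | zero =>
    intro f z hf x y
    exact hf _ _
  | succ r ih =>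
    intro f z hf y
    have := ih _ z (hf y)
    convert this using 4
    ring

lemma DD_smul {n : ℕ} (r : ℕ) : ∀ (f : BF n) (c : ZMod 2), DD r f →
    DD r (fun x => c * f x) := by
  induction r with
  | zero =>
    intro f z hf x y
    simp only [hf x y]
  | succ r ih =>
    intro f z hf y
    have := ih _ z (hf y)
    convert this using 2
    ring

lemma DD_coord_mul {n : ℕ} (i : Fin n) (r : ℕ) : ∀ (f : BF n), DD r f →
    DD (r + 1) (fun x => x i * f x) := by
  induction r with
  | zero =>
    intro f hf y
    apply DD_const
    intro x z
    simp only [hf (x + y) 0, hf (z + y) 0, hf x 0, hf z 0, Pi.add_apply]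
    have hx := CharTwo.add_self_eq_zero (x i * f 0)
    have hz := CharTwo.add_self_eq_zero (z i * f 0)
    linear_combination hx - hz
  | succ r ih =>
    intro f hf y
    have h1 := ih _ (hf y)
    have h2 := DD_smul _ _ (y i) (DD_shift _ f y hf)
    have h3 := DD_add _ _ _ h1 h2
    convert h3 using 2
    simp only [Pi.add_apply]
    ring

lemma DD_prod {n : ℕ} (s : Finset (Fin n)) : DD s.card (fun x : Fin n → ZMod 2 => ∏ i ∈ s, x i) := by
  classical
  induction s using Finset.induction_on with
  | empty => exact DD_const _ _ (by simp)
  | insert a s ha ih =>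
    rw [Finset.card_insert_of_notMem ha]
    have := DD_coord_mul a _ _ ih
    simpa [Finset.prod_insert ha] using this

lemma DD_sum {n : ℕ} {ι : Type*} (r : ℕ) (A : Finset ι) (F : ι → BF n) (h : ∀ i ∈ A, DD r (F i)) :
    DD r (fun x => ∑ i ∈ A, F i x) := by
  classical
  induction A using Finset.induction_on with
  | empty => exact DD_const _ _ (by simp)
  | insert a s ha ih =>
    have := DD_add _ _ _ (h a (by simp)) (ih (fun i hi => h i (by simp [hi])))
    simpa [Finset.sum_insert ha] using this

lemma DD_support {n : ℕ} (r : ℕ) : ∀ f : BF n, DD r f → (∃ x, f x ≠ 0) →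
    2 ^ n ≤ 2 ^ r * (Finset.univ.filter (fun x => f x ≠ 0)).card := by
  induction r with
  | zero =>
    rintro f hf ⟨x, hx⟩
    rw [Finset.filter_true_of_mem]
    · simp
    · intro y _
      rw [hf y x]; exact hx
  | succ r ih =>
    rintro f hf ⟨x, hx⟩
    by_cases h : ∃ y z, f (z + y) + f z ≠ 0
    · obtain ⟨y, z, hz⟩ := h
      have h1 := ih _ (hf y) ⟨z, hz⟩
      have h2 : (Finset.univ.filter (fun x => f (x + y) + f x ≠ 0)).card ≤
          (Finset.univ.filter (fun x => f x ≠ 0)).card + (Finset.univ.filter (fun x => f x ≠ 0)).card := by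
        calc _ ≤ ((Finset.univ.filter (fun x => f x ≠ 0)).image (fun x => x - y) ∪
              (Finset.univ.filter (fun x => f x ≠ 0))).card := by
              apply Finset.card_le_card
              intro w hw
              simp only [Finset.mem_filter, Finset.mem_univ, true_and, Finset.mem_union,
                Finset.mem_image] at hw ⊢
              by_cases h0 : f w = 0
              · left
                refine ⟨w + y, ?_, by simp⟩
                simpa [h0] using hw
              · right; exact h0
          _ ≤ _ := (Finset.card_union_le _ _).trans
              (Nat.add_le_add_right Finset.card_image_le _)
      calc 2 ^ n ≤ _ := h1
        _ ≤ 2 ^ r * _ := Nat.mul_le_mul_left _ h2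
        _ = _ := by ring
    · push Not at h
      rw [Finset.filter_true_of_mem]
      · simp only [Finset.card_univ, Fintype.card_fun, ZMod.card, Fintype.card_fin]
        exact Nat.le_mul_of_pos_left _ (by positivity)
      · intro w _
        have := h (w - x) x
        rw [add_sub_cancel] at this
        intro h0
        rw [h0, zero_add] at this
        exact hx this

lemma const_of_deriv {n : ℕ} (h : BF n) (hh : ∀ i x, h (x + Pi.single i 1) = h x) (x : Fin n → ZMod 2) :
    h x = h 0 := by
  classical
  have key : ∀ s : Finset (Fin n), h (∑ i ∈ s, Pi.single i (x i)) = h 0 := by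
    intro s
    induction s using Finset.induction_on with
    | empty => simp
    | insert a s ha ih =>
      rw [Finset.sum_insert ha, add_comm]
      have h01 : ∀ a : ZMod 2, a = 0 ∨ a = 1 := by decide
      rcases h01 (x a) with h0 | h0
      · rw [h0]; simpa using ih
      · rw [h0, hh, ih]
  have := key Finset.univ
  rwa [Finset.univ_sum_single] at this

lemma DD_card {n : ℕ} (r : ℕ) : Nat.card {f : BF n // DD r f} ≤ 2 ^ ((n + 1) ^ r) := by
  induction r with
  | zero =>
    have : Nat.card {f : BF n // DD 0 f} ≤ Nat.card (ZMod 2) := by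
      apply Nat.card_le_card_of_injective (fun f => f.1 0)
      intro f g h
      ext x
      rw [f.2 x 0, g.2 x 0]
      exact h
    simpa using this
  | succ r ih =>
    have : Nat.card {f : BF n // DD (r + 1) f} ≤
        Nat.card (ZMod 2 × (Fin n → {f : BF n // DD r f})) := by
      apply Nat.card_le_card_of_injective
        (fun f => (f.1 0, fun i => ⟨_, f.2 (Pi.single i 1)⟩))
      intro f g h
      simp only [Prod.mk.injEq] at h
      obtain ⟨h0, h1⟩ := h
      have h2 := const_of_deriv (fun x => f.1 x + g.1 x) (by
        intro i x
        have := congrFun (congrArg Subtype.val (congrFun h1 i)) x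
        simp only at this
        have e1 := CharTwo.add_self_eq_zero (f.1 x)
        have e2 := CharTwo.add_self_eq_zero (g.1 (x + Pi.single i 1))
        have e3 := CharTwo.add_self_eq_zero (g.1 x)
        linear_combination this - e1 + e2 )
      apply Subtype.ext
      funext x
      have h3 := h2 x
      simp only [h0] at h3
      rw [CharTwo.add_self_eq_zero] at h3
      exact CharTwo.add_eq_zero.mp h3
    calc _ ≤ _ := this
      _ = 2 * (Nat.card {f : BF n // DD r f}) ^ n := by
        simp [Nat.card_prod, Nat.card_fun]
      _ ≤ 2 * (2 ^ ((n + 1) ^ r)) ^ n := by gcongr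
      _ = 2 ^ (1 + (n + 1) ^ r * n) := by rw [pow_add, pow_mul, pow_one]
      _ ≤ 2 ^ ((n + 1) ^ (r + 1)) := by
        apply Nat.pow_le_pow_right (by norm_num)
        have : 1 ≤ (n + 1) ^ r := Nat.one_le_pow _ _ (by omega)
        rw [pow_succ]; nlinarith

/-- The sign of an element of `ZMod 2`. -/
def sg (a : ZMod 2) : ℝ := if a = 0 then 1 else -1

lemma zmod2_cases (a : ZMod 2) : a = 0 ∨ a = 1 := by revert a; decide

lemma sg_zero : sg 0 = 1 := by simp [sg]

lemma sg_one : sg 1 = -1 := by simp [sg]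

lemma sg_add (a b : ZMod 2) : sg (a + b) = sg a * sg b := by
  have h11 : (1 : ZMod 2) + 1 = 0 := by decide
  rcases zmod2_cases a with rfl | rfl <;> rcases zmod2_cases b with rfl | rfl <;>
    simp [sg_zero, sg_one, h11]

lemma sg_sq (a : ZMod 2) : sg a ^ 2 = 1 := by
  rcases zmod2_cases a with rfl | rfl <;> simp [sg_zero, sg_one]

/-- Exponential moment contraction constant. -/
lemma rho_lt_one (δ : ℝ) (h0 : 0 < δ) (h1 : δ ≤ 1) : cosh δ - δ * sinh δ < 1 := by
  have e1 := cosh_le_exp_half_sq δ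
  have e2 : δ ≤ sinh δ := Real.self_le_sinh_iff.mpr h0.le
  have e3 : exp (δ ^ 2 / 2) ≤ 1 + δ ^ 2 / 2 + (δ ^ 2 / 2) ^ 2 := by
    have := Real.abs_exp_sub_one_sub_id_le (x := δ ^ 2 / 2) (by
      rw [abs_of_nonneg (by positivity)]; nlinarith)
    have := (abs_le.mp this).2
    linarith
  have hd : 0 < δ ^ 2 := by positivity
  have hd1 : δ ^ 2 ≤ 1 := by nlinarith
  nlinarith

/-- Number of sample tuples for which the sample sum of signs is nonpositive. -/
lemma sample_bound {X : Type*} [Fintype X] (u : X → ZMod 2) (δ : ℝ) (h0 : 0 < δ)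
    (hb : δ * Fintype.card X ≤ ∑ x, sg (u x)) (t : ℕ) :
    ((Finset.univ.filter (fun y : Fin t → X => ∑ i, sg (u (y i)) ≤ 0)).card : ℝ) ≤
      (Fintype.card X * (cosh δ - δ * sinh δ)) ^ t := by
  classical
  have hs : 0 ≤ sinh δ := Real.sinh_nonneg_iff.mpr h0.le
  have e : ∀ a : ZMod 2, exp (-δ * sg a) = cosh δ - sg a * sinh δ := by
    intro a
    rcases zmod2_cases a with rfl | rfl
    · rw [sg_zero, Real.cosh_eq, Real.sinh_eq]; ring_nf
    · rw [sg_one, Real.cosh_eq, Real.sinh_eq]; ring_nf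
  have h1 : ∑ x, exp (-δ * sg (u x)) ≤ Fintype.card X * (cosh δ - δ * sinh δ) := by
    simp only [e, Finset.sum_sub_distrib, Finset.sum_const, ← Finset.sum_mul, Finset.card_univ,
      nsmul_eq_mul]
    nlinarith
  calc _ = ∑ y : Fin t → X, if ∑ i, sg (u (y i)) ≤ 0 then (1 : ℝ) else 0 := by
        simp
    _ ≤ ∑ y : Fin t → X, ∏ i, exp (-δ * sg (u (y i))) := by
        apply Finset.sum_le_sum
        intro y _
        rw [← Real.exp_sum, ← Finset.mul_sum]
        split_ifs with h
        · apply Real.one_le_exp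
          nlinarith
        · positivity
    _ = (∑ x, exp (-δ * sg (u x))) ^ t := by
        rw [← Fintype.prod_sum (fun (_ : Fin t) x => exp (-δ * sg (u x)))]
        simp
    _ ≤ _ := by gcongr

/-- Decoding by majority. -/
def decode {n t : ℕ} (d : Fin t → BF n) (x : Fin n → ZMod 2) : ZMod 2 :=
  if 0 < ∑ i, sg (d i x) then 0 else 1

lemma exists_good_tuple {n : ℕ} (f : BF n) (δ : ℝ) (h0 : 0 < δ)
    (hb : δ * 2 ^ n ≤ ∑ x, sg (f x)) (r t : ℕ) (hρ : 0 ≤ cosh δ - δ * sinh δ)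
    (ht : (cosh δ - δ * sinh δ) ^ t < 1 / 2 ^ (r + 1)) :
    ∃ y : Fin t → (Fin n → ZMod 2),
      ((Finset.univ.filter (fun x => decode (fun i z => f (z + y i) + f z) x ≠ f x)).card : ℝ)
        * 2 ^ (r + 1) < 2 ^ n := by
  classical
  set ρ := cosh δ - δ * sinh δ
  have hX : Fintype.card (Fin n → ZMod 2) = 2 ^ n := by simp
  let B : (Fin t → (Fin n → ZMod 2)) → Finset (Fin n → ZMod 2) := fun y =>
    Finset.univ.filter (fun x => ∑ i, sg (f (x + y i)) ≤ 0)
  have hsum : ∑ y, ((B y).card : ℝ) ≤ 2 ^ n * (2 ^ n * ρ) ^ t := by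
    have h1 : ∑ y, ((B y).card : ℝ) = ∑ x : Fin n → ZMod 2,
        ((Finset.univ.filter (fun y : Fin t → (Fin n → ZMod 2) =>
          ∑ i, sg (f (x + y i)) ≤ 0)).card : ℝ) := by
      simp only [B, Finset.card_filter, Nat.cast_sum]
      rw [Finset.sum_comm]
    rw [h1]
    have h2 : ∀ x : Fin n → ZMod 2, ((Finset.univ.filter (fun y : Fin t → (Fin n → ZMod 2) =>
          ∑ i, sg (f (x + y i)) ≤ 0)).card : ℝ) ≤ (2 ^ n * ρ) ^ t := by
      intro x
      have := sample_bound (fun z => f (x + z)) δ h0 (by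
        rw [hX]
        have hsc := Equiv.sum_comp (Equiv.addLeft x) (fun z => sg (f z))
        simp only [Equiv.coe_addLeft] at hsc
        rw [hsc]
        simpa using hb) t
      rw [hX] at this
      simpa using this
    calc _ ≤ ∑ x : Fin n → ZMod 2, (2 ^ n * ρ) ^ t := Finset.sum_le_sum (fun x _ => h2 x)
      _ = _ := by simp
  have hex : ∃ y, ((B y).card : ℝ) * 2 ^ (r + 1) < 2 ^ n := by
    by_contra hcon
    push Not at hcon
    have h3 : ∑ y : Fin t → (Fin n → ZMod 2), (2 ^ n : ℝ) ≤ ∑ y, ((B y).card : ℝ) * 2 ^ (r + 1) :=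
      Finset.sum_le_sum (fun y _ => hcon y)
    rw [← Finset.sum_mul] at h3
    simp only [Finset.sum_const, Finset.card_univ, Fintype.card_fun, ZMod.card, Fintype.card_fin,
      nsmul_eq_mul, Nat.cast_pow, Nat.cast_ofNat] at h3
    have h4 : ((2 : ℝ) ^ n) ^ t * 2 ^ n ≤ 2 ^ n * (2 ^ n * ρ) ^ t * 2 ^ (r + 1) :=
      h3.trans (by gcongr)
    rw [mul_pow] at h4
    have hp : (0 : ℝ) < (2 ^ n) ^ t * 2 ^ n := by positivity
    have h5 : ρ ^ t * 2 ^ (r + 1) < 1 := by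
      rwa [lt_div_iff₀ (by positivity)] at ht
    nlinarith
  obtain ⟨y, hy⟩ := hex
  refine ⟨y, lt_of_le_of_lt ?_ hy⟩
  gcongr
  intro x hx
  simp only [Finset.mem_filter, Finset.mem_univ, true_and, B] at hx ⊢
  by_contra hpos
  push Not at hpos
  apply hx
  simp only [decode, sg_add, ← Finset.sum_mul]
  rcases zmod2_cases (f x) with h | h
  · rw [h, sg_zero, mul_one, if_pos hpos]
  · rw [h, sg_one, if_neg]
    linarith

lemma bad_card {n : ℕ} (δ : ℝ) (h0 : 0 < δ) (h1 : δ ≤ 1) (k t : ℕ)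
    (ht : (cosh δ - δ * sinh δ) ^ t < 1 / 2 ^ (k + 1 + 1)) :
    Nat.card {f : BF n // DD (k + 1) f ∧ δ * 2 ^ n ≤ ∑ x, sg (f x)} ≤ 2 ^ (t * (n + 1) ^ k) := by
  classical
  by_cases hρ : 0 ≤ cosh δ - δ * sinh δ
  swap
  · exfalso
    have e1 := Real.sinh_lt_cosh δ
    have e2 : 0 ≤ sinh δ := Real.sinh_nonneg_iff.mpr h0.le
    nlinarith
  have hg : ∀ f : {f : BF n // DD (k + 1) f ∧ δ * 2 ^ n ≤ ∑ x, sg (f x)}, _ :=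
    fun f => exists_good_tuple f.1 δ h0 f.2.2 (k + 1) t hρ ht
  choose y hy using hg
  have : Nat.card {f : BF n // DD (k + 1) f ∧ δ * 2 ^ n ≤ ∑ x, sg (f x)} ≤
      Nat.card (Fin t → {f : BF n // DD k f}) := by
    apply Nat.card_le_card_of_injective
      (fun f i => (⟨fun z => f.1 (z + y f i) + f.1 z, f.2.1 (y f i)⟩ : {f : BF n // DD k f}))
    intro f g hfg
    have hd : (fun i z => f.1 (z + y f i) + f.1 z) = (fun i z => g.1 (z + y g i) + g.1 z) := by
      funext i
      exact congrArg Subtype.val (congrFun hfg i)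
    have hyf := hy f
    have hyg := hy g
    rw [← hd] at hyg
    set d := (fun i z => f.1 (z + y f i) + f.1 z)
    by_contra hne
    have hx : ∃ x, f.1 x + g.1 x ≠ 0 := by
      by_contra hcon
      push Not at hcon
      apply hne
      apply Subtype.ext
      funext x
      exact CharTwo.add_eq_zero.mp (hcon x)
    have hsup := DD_support _ _ (DD_add _ _ _ f.2.1 g.2.1) hx
    have hcard : (Finset.univ.filter (fun x => f.1 x + g.1 x ≠ 0)).card ≤
        (Finset.univ.filter (fun x => decode d x ≠ f.1 x)).card +
        (Finset.univ.filter (fun x => decode d x ≠ g.1 x)).card := by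
      refine le_trans (Finset.card_le_card ?_) (Finset.card_union_le _ _)
      intro x hx
      simp only [Finset.mem_filter, Finset.mem_univ, true_and, Finset.mem_union] at hx ⊢
      by_contra hcon
      push Not at hcon
      apply hx
      rw [← hcon.1, ← hcon.2]
      exact CharTwo.add_self_eq_zero _
    have hsup' : (2 : ℝ) ^ n ≤ 2 ^ (k + 1) *
      ((Finset.univ.filter (fun x => f.1 x + g.1 x ≠ 0)).card : ℝ) := by exact_mod_cast hsup
    have hcard' : ((Finset.univ.filter (fun x => f.1 x + g.1 x ≠ 0)).card : ℝ) ≤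
        ((Finset.univ.filter (fun x => decode d x ≠ f.1 x)).card : ℝ) +
        ((Finset.univ.filter (fun x => decode d x ≠ g.1 x)).card : ℝ) := by exact_mod_cast hcard
    have hp : (0 : ℝ) < 2 ^ (k + 1) := by positivity
    have hm := mul_le_mul_of_nonneg_left hcard' hp.le
    rw [pow_succ _ (k + 1)] at hyf hyg
    linarith
  calc _ ≤ _ := this
    _ = (Nat.card {f : BF n // DD k f}) ^ t := by simp
    _ ≤ (2 ^ ((n + 1) ^ k)) ^ t := by gcongr; exact DD_card k
    _ = _ := by rw [← pow_mul, mul_comm]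

/-- Correlation of two Boolean functions. -/
def cor {n : ℕ} (f g : BF n) : ℝ := ∑ x, sg (f x) * sg (g x)

lemma cor_eq {n : ℕ} (f g : BF n) : cor f g = 2 ^ n - 2 * (hdist f g : ℝ) := by
  classical
  have h1 : hdist f g = (Finset.univ.filter (fun x => f x ≠ g x)).card := by
    unfold hdist
    rw [Nat.card_eq_fintype_card, Fintype.card_subtype]
    rfl
  have h2 : ∀ x, sg (f x) * sg (g x) = 1 - 2 * (if f x ≠ g x then (1 : ℝ) else 0) := by
    intro x
    rcases zmod2_cases (f x) with h | h <;> rcases zmod2_cases (g x) with h' | h' <;>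
      rw [h, h'] <;> norm_num [sg_zero, sg_one]
  rw [h1, cor]
  rw [Finset.card_filter, Nat.cast_sum]
  simp only [h2, Finset.sum_sub_distrib, ← Finset.mul_sum]
  simp

/-- Chernoff bound for uniformly random Boolean functions. -/
lemma chernoff {n : ℕ} (c : (Fin n → ZMod 2) → ℝ) (μ s : ℝ) (hs : 0 ≤ s) :
    ((Finset.univ.filter (fun f : BF n => μ ≤ ∑ x, sg (f x) * c x)).card : ℝ) ≤
      2 ^ (2 ^ n) * exp (s ^ 2 * (∑ x, c x ^ 2) / 2 - s * μ) := by
  classical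
  have e : ∀ x, ∑ a : ZMod 2, exp (s * (sg a * c x)) ≤ 2 * exp (s ^ 2 * c x ^ 2 / 2) := by
    intro x
    have h : ∑ a : ZMod 2, exp (s * (sg a * c x)) = 2 * cosh (s * c x) := by
      have : (Finset.univ : Finset (ZMod 2)) = {0, 1} := by decide
      rw [this, Finset.sum_pair (by decide), sg_zero, sg_one, Real.cosh_eq]
      ring_nf
    rw [h]
    have := cosh_le_exp_half_sq (s * c x)
    rw [mul_pow] at this
    linarith
  calc _ = ∑ f : BF n, if μ ≤ ∑ x, sg (f x) * c x then (1 : ℝ) else 0 := by simp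
    _ ≤ ∑ f : BF n, exp (-(s * μ)) * ∏ x, exp (s * (sg (f x) * c x)) := by
        apply Finset.sum_le_sum
        intro f _
        rw [← Real.exp_sum, ← Finset.mul_sum, ← Real.exp_add]
        split_ifs with h
        · apply Real.one_le_exp
          nlinarith
        · positivity
    _ = exp (-(s * μ)) * ∏ x, ∑ a : ZMod 2, exp (s * (sg a * c x)) := by
        rw [← Finset.mul_sum, Fintype.prod_sum (fun x a => exp (s * (sg a * c x)))]
    _ ≤ exp (-(s * μ)) * ∏ x, (2 * exp (s ^ 2 * c x ^ 2 / 2)) := by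
        gcongr with x
        exact e x
    _ = _ := by
        rw [Finset.prod_mul_distrib, ← Real.exp_sum, ← Finset.sum_div, ← Finset.mul_sum]
        simp only [Finset.prod_const, Finset.card_univ, Fintype.card_fun, ZMod.card, Fintype.card_fin]
        rw [sub_eq_add_neg, Real.exp_add]
        ring

lemma single_upper {n : ℕ} (g : BF n) (l c0 : ℝ) (hl : 0 ≤ l) (hl2 : l ^ 2 = 2 * 2 ^ n * c0) :
    ((Finset.univ.filter (fun f : BF n => l ≤ cor f g)).card : ℝ) ≤
      2 ^ (2 ^ n) * exp (-c0) := by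
  have := chernoff (fun x => sg (g x)) l (l / 2 ^ n) (by positivity)
  simp only [sg_sq] at this
  simp only [cor]
  refine this.trans (le_of_eq ?_)
  congr 2
  simp only [Finset.sum_const, Finset.card_univ, Fintype.card_fun, ZMod.card, Fintype.card_fin,
      nsmul_eq_mul, Nat.cast_pow, Nat.cast_ofNat, mul_one]
  have hp : (2 : ℝ) ^ n ≠ 0 := by positivity
  field_simp
  rw [hl2]; ring

lemma pair_upper {n : ℕ} (g g' : BF n) (l c0 δ : ℝ) (hl : 0 ≤ l) (hl2 : l ^ 2 = 2 * 2 ^ n * c0)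
    (hc : cor g g' ≤ δ * 2 ^ n) :
    ((Finset.univ.filter (fun f : BF n => l ≤ cor f g ∧ l ≤ cor f g')).card : ℝ) ≤
      2 ^ (2 ^ n) * exp (-(2 * c0 * (1 - δ))) := by
  have := chernoff (fun x => sg (g x) + sg (g' x)) (2 * l) (l / 2 ^ n) (by positivity)
  refine le_trans ?_ (this.trans ?_)
  · gcongr
    intro hf
    simp only [cor] at hf
    simp only [mul_add, Finset.sum_add_distrib]
    linarith [hf.1, hf.2]
  · gcongr
    have hs : ∑ x, (sg (g x) + sg (g' x)) ^ 2 = 2 * 2 ^ n + 2 * cor g g' := by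
      simp only [add_sq, sg_sq, cor, Finset.mul_sum, Finset.sum_add_distrib]
      simp only [Finset.sum_const, Finset.card_univ, Fintype.card_fun, ZMod.card, Fintype.card_fin,
        nsmul_eq_mul, Nat.cast_pow, Nat.cast_ofNat, mul_one]
      simp only [mul_assoc]
      ring
    rw [hs]
    have hp : (0 : ℝ) < 2 ^ n := by positivity
    have h1 : (l / 2 ^ n) ^ 2 * (2 * 2 ^ n + 2 * cor g g') / 2 ≤
        (l / 2 ^ n) ^ 2 * (2 * 2 ^ n + 2 * (δ * 2 ^ n)) / 2 := by gcongr
    have h2 : (l / 2 ^ n) ^ 2 * (2 * 2 ^ n + 2 * (δ * 2 ^ n)) / 2 - l / 2 ^ n * (2 * l)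
        = -(2 * c0 * (1 - δ)) := by
      field_simp
      rw [hl2]; ring
    linarith

open Classical in
lemma second_moment {n : ℕ} (W : Finset (BF n)) (l P U1 U2 : ℝ) (b : ℕ) (hP : 0 ≤ P)
    (δ : ℝ) (hU1 : 0 ≤ U1) (hU2 : 0 ≤ U2)
    (hPl : ∀ g ∈ W, P ≤ ((Finset.univ.filter (fun f : BF n => l ≤ cor f g)).card : ℝ))
    (h1 : ∀ g ∈ W, ((Finset.univ.filter (fun f : BF n => l ≤ cor f g)).card : ℝ) ≤ U1)
    (h2 : ∀ g ∈ W, ∀ g' ∈ W, cor g g' ≤ δ * 2 ^ n →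
      ((Finset.univ.filter (fun f : BF n => l ≤ cor f g ∧ l ≤ cor f g')).card : ℝ) ≤ U2)
    (hb : ∀ g ∈ W, (W.filter (fun g' => δ * 2 ^ n ≤ cor g g')).card ≤ b)
    (hW : 0 < W.card) :
    W.card * P ^ 2 ≤ ((Finset.univ.filter (fun f : BF n => ∃ g ∈ W, l ≤ cor f g)).card : ℝ) *
      (b * U1 + W.card * U2) := by
  set E := Finset.univ.filter (fun f : BF n => ∃ g ∈ W, l ≤ cor f g) with hE
  let N : BF n → ℝ := fun f => ∑ g ∈ W, if l ≤ cor f g then (1 : ℝ) else 0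
  have hN0 : ∀ f, f ∉ E → N f = 0 := by
    intro f hf
    simp only [hE, Finset.mem_filter, Finset.mem_univ, true_and, not_exists, not_and] at hf
    exact Finset.sum_eq_zero (fun g hg => if_neg (hf g hg))
  have hsum : W.card * P ≤ ∑ f ∈ E, N f := by
    rw [Finset.sum_subset (Finset.subset_univ E) (fun f _ hf => hN0 f hf)]
    simp only [N]
    rw [Finset.sum_comm]
    calc (W.card : ℝ) * P = ∑ g ∈ W, P := by simp
      _ ≤ _ := by
        apply Finset.sum_le_sum
        intro g hg
        refine (hPl g hg).trans (le_of_eq ?_)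
        simp
  have hsq : ∑ f ∈ E, N f ^ 2 ≤ W.card * (b * U1 + W.card * U2) := by
    calc ∑ f ∈ E, N f ^ 2 ≤ ∑ f, N f ^ 2 :=
          Finset.sum_le_sum_of_subset_of_nonneg (Finset.subset_univ E) (fun f _ _ => sq_nonneg _)
      _ = ∑ g ∈ W, ∑ g' ∈ W,
          ((Finset.univ.filter (fun f : BF n => l ≤ cor f g ∧ l ≤ cor f g')).card : ℝ) := by
          simp only [N, sq, Finset.sum_mul_sum]
          rw [Finset.sum_comm]
          apply Finset.sum_congr rfl
          intro g _
          rw [Finset.sum_comm]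
          apply Finset.sum_congr rfl
          intro g' _
          rw [Finset.card_filter, Nat.cast_sum]
          apply Finset.sum_congr rfl
          intro f _
          by_cases ha : l ≤ cor f g <;> by_cases hb : l ≤ cor f g' <;> simp [ha, hb]
      _ ≤ ∑ g ∈ W, (b * U1 + W.card * U2) := by
          apply Finset.sum_le_sum
          intro g hg
          calc _ ≤ ∑ g' ∈ W, ((if δ * 2 ^ n ≤ cor g g' then U1 else 0) + U2) := by
                apply Finset.sum_le_sum
                intro g' hg'
                split_ifs with hc
                · have : ((Finset.univ.filter (fun f : BF n => l ≤ cor f g ∧ l ≤ cor f g')).card : ℝ)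
                    ≤ ((Finset.univ.filter (fun f : BF n => l ≤ cor f g)).card : ℝ) := by
                    gcongr with f
                    exact fun h => h.1
                  linarith [h1 g hg]
                · have := h2 g hg g' hg' (not_le.mp hc).le
                  linarith
            _ = (W.filter (fun g' => δ * 2 ^ n ≤ cor g g')).card * U1 + W.card * U2 := by
                rw [Finset.sum_add_distrib, ← Finset.sum_filter]
                simp
            _ ≤ _ := by
                gcongr
                exact hb g hg
      _ = _ := by rw [Finset.sum_const, nsmul_eq_mul]
  have hcs : (∑ f ∈ E, N f) ^ 2 ≤ E.card * ∑ f ∈ E, N f ^ 2 := sq_sum_le_card_mul_sum_sq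
  have hWp : (0 : ℝ) < W.card := by exact_mod_cast hW
  have h5 : (W.card * P) ^ 2 ≤ E.card * (W.card * (b * U1 + W.card * U2)) := by
    calc _ ≤ (∑ f ∈ E, N f) ^ 2 := by gcongr
      _ ≤ _ := hcs
      _ ≤ _ := by gcongr
  have h6 : W.card * (W.card * P ^ 2) ≤ W.card * (E.card * (b * U1 + W.card * U2)) := by
    linarith [h5, mul_pow (W.card : ℝ) P 2, (by ring : (W.card : ℝ) ^ 2 * P ^ 2 = W.card * (W.card * P ^ 2)), (by ring : (E.card : ℝ) * (W.card * (b * U1 + W.card * U2)) = W.card * (E.card * (b * U1 + W.card * U2)))]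
  exact le_of_mul_le_mul_left h6 hWp

lemma central_bound (h : ℕ) (hh : 1 ≤ h) : 16 ^ h ≤ 4 * h * (Nat.centralBinom h) ^ 2 := by
  induction h, hh using Nat.le_induction with
  | base => simp [Nat.centralBinom]
  | succ h hh ih =>
    have h1 := Nat.succ_mul_centralBinom_succ h
    have h2 : (h + 1) * (4 * (h + 1) * (Nat.centralBinom (h + 1)) ^ 2) =
        16 * (2 * h + 1) ^ 2 * (Nat.centralBinom h) ^ 2 := by
      calc _ = 4 * ((h + 1) * (Nat.centralBinom (h + 1))) ^ 2 := by ring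
        _ = _ := by rw [h1]; ring
    have h3 : (h + 1) * 16 ^ (h + 1) ≤ (h + 1) * (4 * (h + 1) * (Nat.centralBinom (h + 1)) ^ 2) := by
      rw [h2]
      calc (h + 1) * 16 ^ (h + 1) = 16 * (h + 1) * 16 ^ h := by ring
        _ ≤ 16 * (h + 1) * (4 * h * (Nat.centralBinom h) ^ 2) := by gcongr
        _ = 16 * (4 * h * (h + 1)) * (Nat.centralBinom h) ^ 2 := by ring
        _ ≤ 16 * (2 * h + 1) ^ 2 * (Nat.centralBinom h) ^ 2 := by
          gcongr
          nlinarith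
    exact Nat.le_of_mul_le_mul_left h3 (by omega)

lemma central_bound_real (h : ℕ) (hh : 1 ≤ h) :
    (4 : ℝ) ^ h ≤ 2 * √h * (Nat.centralBinom h : ℝ) := by
  have h1 : ((16 : ℝ)) ^ h ≤ 4 * h * (Nat.centralBinom h : ℝ) ^ 2 := by
    exact_mod_cast central_bound h hh
  apply le_of_sq_le_sq _ (by positivity)
  rw [mul_pow, mul_pow, Real.sq_sqrt (by positivity), ← pow_mul, mul_comm h 2, pow_mul]
  norm_num
  exact h1

lemma one_sub_ge_exp (u : ℝ) (h0 : 0 ≤ u) (h1 : u ≤ 1 / 2) : exp (-(u + 2 * u ^ 2)) ≤ 1 - u := by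
  have hp : 0 < 1 - u := by linarith
  have e1 := Real.one_sub_inv_le_log_of_pos hp
  have e2 : -(u + 2 * u ^ 2) ≤ 1 - (1 - u)⁻¹ := by
    have : (1 - u)⁻¹ ≤ 1 + u + 2 * u ^ 2 := by
      rw [inv_le_iff_one_le_mul₀ hp]
      nlinarith [mul_nonneg (sq_nonneg u) (by linarith : 0 ≤ 1 / 2 - u)]
    linarith
  rw [← Real.le_log_iff_exp_le hp]
  linarith

lemma choose_lower (h J : ℕ) (hh : 1 ≤ h) (hJ : 4 * J ≤ h) : ∀ j, j ≤ J →
    (Nat.centralBinom h : ℝ) * exp (-((j : ℝ) ^ 2 / h + j * (8 * (J : ℝ) ^ 2 / (h : ℝ) ^ 2))) ≤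
      ((2 * h).choose (h + j) : ℝ) := by
  intro j
  have hhp : (0 : ℝ) < h := by exact_mod_cast hh
  induction j with
  | zero => intro _; simp [Nat.centralBinom]
  | succ j ih =>
    intro hj
    have ih' := ih (by omega)
    have hrec : ((2 * h).choose (h + j + 1) : ℝ) * (h + j + 1) = (2 * h).choose (h + j) * (h - j) := by
      have := Nat.choose_succ_right_eq (2 * h) (h + j)
      have h2 : 2 * h - (h + j) = h - j := by omega
      rw [h2] at this
      have h3 : (((2 * h).choose (h + j + 1) * (h + j + 1) : ℕ) : ℝ)
        = (((2 * h).choose (h + j) * (h - j) : ℕ) : ℝ) := by exact_mod_cast this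
      rw [Nat.cast_mul, Nat.cast_mul, Nat.cast_sub (by omega)] at h3
      push_cast at h3
      exact h3
    set u : ℝ := (2 * j + 1) / h with hu
    have hjJ : (j : ℝ) + 1 ≤ J := by exact_mod_cast hj
    have hJr : 4 * (J : ℝ) ≤ h := by exact_mod_cast hJ
    have hj0 : (0 : ℝ) ≤ j := by positivity
    have hu1 : u ≤ 1 / 2 := by
      rw [hu, div_le_iff₀ hhp]; linarith
    have hu0 : 0 ≤ u := by positivity
    have hu2 : 2 * u ^ 2 ≤ 8 * (J : ℝ) ^ 2 / (h : ℝ) ^ 2 := by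
      rw [hu, div_pow, ← mul_div_assoc]
      apply div_le_div_of_nonneg_right _ (by positivity)
      nlinarith
    have hratio : 1 - u ≤ (h - j) / (h + j + 1) := by
      rw [le_div_iff₀ (by positivity), hu]
      have : (1 - (2 * (j : ℝ) + 1) / h) * (h + j + 1) = h - j - (2 * j + 1) * (j + 1) / h := by
        field_simp
        ring
      rw [this]
      have : 0 ≤ (2 * (j : ℝ) + 1) * (j + 1) / h := by positivity
      linarith
    have hc : ((2 * h).choose (h + (j + 1)) : ℝ) = (2 * h).choose (h + j) * ((h - j) / (h + j + 1)) := by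
      rw [← mul_div_assoc, eq_div_iff (by positivity), ← hrec]
      rfl
    rw [hc]
    calc _ ≤ (Nat.centralBinom h : ℝ) *
          (exp (-((j : ℝ) ^ 2 / h + j * (8 * (J : ℝ) ^ 2 / (h : ℝ) ^ 2))) * exp (-(u + 2 * u ^ 2))) := by
          rw [← Real.exp_add]
          gcongr
          have : ((j + 1 : ℕ) : ℝ) ^ 2 / h = (j : ℝ) ^ 2 / h + u := by
            rw [hu]; push_cast; field_simp; ring
          rw [this]
          push_cast
          linarith
      _ = ((Nat.centralBinom h : ℝ) *
          exp (-((j : ℝ) ^ 2 / h + j * (8 * (J : ℝ) ^ 2 / (h : ℝ) ^ 2)))) * exp (-(u + 2 * u ^ 2)) := by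
          ring
      _ ≤ (2 * h).choose (h + j) * ((h - j) / (h + j + 1)) := by
          gcongr
          exact (one_sub_ge_exp u hu0 hu1).trans hratio

/-- Counting Boolean functions by the number of zeros. -/
lemma count_lower {n : ℕ} (g : BF n) (l : ℝ) (A : Finset ℕ)
    (hA : ∀ a ∈ A, l ≤ 2 * (a : ℝ) - 2 ^ n) :
    ∑ a ∈ A, (2 ^ n).choose a ≤ (Finset.univ.filter (fun f : BF n => l ≤ cor f g)).card := by
  classical
  have h1 : ∑ a ∈ A, (2 ^ n).choose a =
      (Finset.univ.filter (fun S : Finset (Fin n → ZMod 2) => S.card ∈ A)).card := by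
    rw [Finset.card_eq_sum_card_fiberwise (f := Finset.card) (t := A)]
    · apply Finset.sum_congr rfl
      intro a ha
      have : (Finset.univ.filter (fun S : Finset (Fin n → ZMod 2) => S.card ∈ A)).filter
          (fun S => S.card = a) = Finset.powersetCard a Finset.univ := by
        ext S
        simp only [Finset.mem_filter, Finset.mem_univ, true_and, Finset.mem_powersetCard,
          Finset.subset_univ]
        constructor
        · exact fun h => h.2
        · intro h; exact ⟨h ▸ ha, h⟩
      rw [this, Finset.card_powersetCard]
      simp
    · intro S hS
      simpa using hS
  rw [h1]
  apply Finset.card_le_card_of_injOn (fun S x => (if x ∈ S then 0 else 1) + g x)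
  · intro S hS
    simp only [Finset.coe_filter, Finset.mem_univ, true_and, Set.mem_ofPred_eq] at hS ⊢
    refine (hA _ hS).trans (le_of_eq ?_)
    have : ∀ x, sg ((if x ∈ S then 0 else 1) + g x) * sg (g x) =
        2 * (if x ∈ S then (1 : ℝ) else 0) - 1 := by
      intro x
      rw [sg_add, mul_assoc, ← sq, sg_sq]
      split_ifs
      · rw [sg_zero]; norm_num
      · rw [sg_one]; norm_num
    simp only [cor, this, Finset.sum_sub_distrib, ← Finset.mul_sum]
    simp
  · intro S _ T _ h
    ext x
    have := congrFun h x
    simp only [add_left_inj] at this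
    by_cases hS : x ∈ S <;> by_cases hT : x ∈ T <;> simp_all

lemma single_lower (k : ℕ) (g : BF (k + 1)) (l c0 : ℝ) (hc : 0 ≤ c0)
    (hl : l = 2 * (√((2 : ℝ) ^ k) * √c0))
    (hK : 8 * (√c0 + 3) ^ 3 ≤ √((2 : ℝ) ^ k)) :
    2 ^ (2 ^ (k + 1)) * exp (-(c0 + 6 * √c0 + 11)) ≤
      ((Finset.univ.filter (fun f : BF (k + 1) => l ≤ cor f g)).card : ℝ) := by
  set h : ℕ := 2 ^ k with hh
  have hhr : ((2 : ℝ) ^ k) = (h : ℝ) := by rw [hh]; push_cast; rfl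
  rw [hhr] at hl hK
  have hh1 : 1 ≤ h := Nat.one_le_pow _ _ (by norm_num)
  have hhp : (1 : ℝ) ≤ h := by exact_mod_cast hh1
  set q := √(h : ℝ) with hq
  have hqq : q ^ 2 = h := Real.sq_sqrt (by positivity)
  have hq1 : 1 ≤ q := Real.one_le_sqrt.mpr hhp
  set c := √c0 with hcdef
  have hcc : c ^ 2 = c0 := Real.sq_sqrt hc
  have hc0 : 0 ≤ c := Real.sqrt_nonneg _
  set J0 := ⌈q * c⌉₊ with hJ0
  set L := ⌈q⌉₊ with hL
  have hJ0a : q * c ≤ J0 := Nat.le_ceil _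
  have hJ0b : (J0 : ℝ) < q * c + 1 := Nat.ceil_lt_add_one (by positivity)
  have hLa : q ≤ L := Nat.le_ceil _
  have hLb : (L : ℝ) < q + 1 := Nat.ceil_lt_add_one (by positivity)
  set J := J0 + L with hJ
  have hJr : (J : ℝ) ≤ q * (c + 3) := by
    rw [hJ]; push_cast; nlinarith
  have hJ0' : (0 : ℝ) ≤ J := by positivity
  have h4J : 4 * J ≤ h := by
    have : 4 * (J : ℝ) ≤ h := by
      rw [← hqq]
      have : 4 * (c + 3) ≤ q := by nlinarith [sq_nonneg (c + 3), mul_nonneg hc0 hc0]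
      nlinarith
    exact_mod_cast this
  have hcl := count_lower g l ((Finset.Ico J0 J).image (fun j => h + j)) (by
    intro a ha
    simp only [Finset.mem_image, Finset.mem_Ico] at ha
    obtain ⟨j, ⟨hj, _⟩, rfl⟩ := ha
    have : (J0 : ℝ) ≤ j := by exact_mod_cast hj
    rw [hl, pow_succ, hhr]
    push_cast
    linarith)
  rw [Finset.sum_image (by intro a _ b _ hab; simpa using hab)] at hcl
  have hn : 2 ^ (k + 1) = 2 * h := by rw [hh]; ring
  rw [hn] at hcl ⊢
  have hcl' : ∑ j ∈ Finset.Ico J0 J, ((2 * h).choose (h + j) : ℝ) ≤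
    ((Finset.univ.filter (fun f : BF (k + 1) => l ≤ cor f g)).card : ℝ) := by exact_mod_cast hcl
  refine le_trans ?_ hcl'
  have hterm : ∀ j ∈ Finset.Ico J0 J, (Nat.centralBinom h : ℝ) * exp (-(c0 + 6 * c + 10)) ≤
      ((2 * h).choose (h + j) : ℝ) := by
    intro j hj
    rw [Finset.mem_Ico] at hj
    refine le_trans ?_ (choose_lower h J hh1 h4J j hj.2.le)
    have hjJ : (j : ℝ) ≤ J := by exact_mod_cast hj.2.le
    apply mul_le_mul_of_nonneg_left _ (by positivity)
    apply Real.exp_le_exp.mpr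
    have e1 : (j : ℝ) ^ 2 / h ≤ c0 + 6 * c + 9 := by
      rw [div_le_iff₀ (by linarith)]
      calc (j : ℝ) ^ 2 ≤ (q * (c + 3)) ^ 2 := by
            gcongr; linarith
        _ = _ := by rw [mul_pow, hqq, ← hcc]; ring
    have e2 : (j : ℝ) * (8 * (J : ℝ) ^ 2 / (h : ℝ) ^ 2) ≤ 1 := by
      rw [← mul_div_assoc, div_le_one (by positivity)]
      calc (j : ℝ) * (8 * (J : ℝ) ^ 2) ≤ (q * (c + 3)) * (8 * (q * (c + 3)) ^ 2) := by
            gcongr; linarith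
        _ = q ^ 3 * (8 * (c + 3) ^ 3) := by ring
        _ ≤ q ^ 3 * q := by gcongr
        _ = (q ^ 2) ^ 2 := by ring
        _ = _ := by rw [hqq]
    linarith
  have hfin := Finset.sum_le_sum hterm
  refine le_trans ?_ hfin
  rw [Finset.sum_const, Nat.card_Ico, nsmul_eq_mul]
  have hLJ : J - J0 = L := by omega
  rw [hLJ]
  have hcb := central_bound_real h hh1
  have hexp : exp (-(c0 + 6 * c + 11)) ≤ exp (-(c0 + 6 * c + 10)) * (1 / 2) := by
    have : -(c0 + 6 * c + 11) = -(c0 + 6 * c + 10) + (-1) := by ring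
    rw [this, Real.exp_add]
    gcongr
    rw [Real.exp_neg, one_div]
    apply inv_anti₀ (by norm_num)
    have := Real.add_one_le_exp (1 : ℝ)
    linarith
  rw [pow_mul]
  norm_num only
  calc (4 : ℝ) ^ h * exp (-(c0 + 6 * c + 11)) ≤ (2 * q * (Nat.centralBinom h : ℝ)) *
        (exp (-(c0 + 6 * c + 10)) * (1 / 2)) := by gcongr
    _ = q * ((Nat.centralBinom h : ℝ) * exp (-(c0 + 6 * c + 10))) := by ring
    _ ≤ _ := by gcongr

lemma exists_W (n r : ℕ) : ∃ W : Finset (BF n), W.card = 2 ^ (n.choose r) ∧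
    ∀ g ∈ W, g ∈ RM r n ∧ DD r g := by
  classical
  let F : Finset (Finset (Fin n)) → BF n := fun A x => ∑ s ∈ A, ∏ i ∈ s, x i
  refine ⟨(Finset.powerset (Finset.powersetCard r Finset.univ)).image F, ?_, ?_⟩
  · rw [Finset.card_image_of_injOn, Finset.card_powerset, Finset.card_powersetCard]
    · simp
    · have key : ∀ A ⊆ Finset.powersetCard r (Finset.univ : Finset (Fin n)),
          ∀ T ∈ Finset.powersetCard r (Finset.univ : Finset (Fin n)),
          F A (fun i => if i ∈ T then 1 else 0) = if T ∈ A then 1 else 0 := by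
        intro A hA T hT
        have : ∀ s ∈ A, (∏ i ∈ s, (if i ∈ T then (1 : ZMod 2) else 0)) = if s = T then 1 else 0 := by
          intro s hs
          have hs' := (Finset.mem_powersetCard.mp (hA hs)).2
          have hT' := (Finset.mem_powersetCard.mp hT).2
          split_ifs with h
          · subst h
            exact Finset.prod_eq_one (fun i hi => if_pos hi)
          · have : ¬ s ⊆ T := fun hsub => h (Finset.eq_of_subset_of_card_le hsub (by omega))
            obtain ⟨i, hi, hiT⟩ := Finset.not_subset.mp this
            exact Finset.prod_eq_zero hi (if_neg hiT)
        simp only [F]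
        rw [Finset.sum_congr rfl this]
        simp
      intro A hA B hB hAB
      simp only [Finset.coe_powerset, Set.mem_preimage, Set.mem_powerset_iff,
        Finset.coe_subset] at hA hB
      ext T
      by_cases hT : T ∈ Finset.powersetCard r (Finset.univ : Finset (Fin n))
      · have h1 := key A hA T hT
        have h2 := key B hB T hT
        rw [hAB, h2] at h1
        by_cases hTA : T ∈ A <;> by_cases hTB : T ∈ B <;> simp_all
      · exact ⟨fun h => absurd (hA h) hT, fun h => absurd (hB h) hT⟩
  · intro g hg
    obtain ⟨A, hA, rfl⟩ := Finset.mem_image.mp hg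
    rw [Finset.mem_powerset] at hA
    constructor
    · refine ⟨∑ s ∈ A, ∏ i ∈ s, MvPolynomial.X i, ?_, ?_⟩
      · apply MvPolynomial.totalDegree_finsetSum_le
        intro s hs
        refine (MvPolynomial.totalDegree_finsetProd _ _).trans ?_
        simp only [MvPolynomial.totalDegree_X, Finset.sum_const, smul_eq_mul, mul_one]
        exact (Finset.mem_powersetCard.mp (hA hs)).2.le
      · intro x
        simp [F, map_sum, map_prod]
    · apply DD_sum
      intro s hs
      have := DD_prod s
      rwa [(Finset.mem_powersetCard.mp (hA hs)).2] at this

lemma main_finite (k r t : ℕ) (α c0 : ℝ) (hα0 : 0 < α) (hα1 : α < 1)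
    (ht : (cosh (α / 4) - α / 4 * sinh (α / 4)) ^ t < 1 / 2 ^ (r + 1 + 1))
    (hc0 : c0 = ((k + 1).choose (r + 1) : ℝ) * Real.log 2)
    (h1 : 8 * (√c0 + 3) ^ 3 ≤ √((2 : ℝ) ^ k))
    (h2 : 6 * √c0 + 11 ≤ α / 4 * c0)
    (h3 : (t : ℝ) * ((k + 1 : ℕ) + 1 : ℝ) ^ r ≤ α / 2 * ((k + 1).choose (r + 1) : ℝ))
    (h4 : Real.log 2 ≤ α * c0) :
    (1:ℝ) / (4:ℝ) ^ (α * ((k + 1).choose (r + 1) : ℝ)) ≤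
        (Nat.card {g : BF (k + 1) |
            Real.sqrt (2^(k + 1 +1) * ((k + 1).choose (r + 1)) * Real.log 2) ≤
              (2^(k + 1) : ℝ) - 2 * nonlin (r + 1) g} : ℝ)
          / 2^(2^(k + 1)) := by
  classical
  have hlog : 0 < Real.log 2 := Real.log_pos (by norm_num)
  have hc : 0 ≤ c0 := by rw [hc0]; positivity
  set C := (k + 1).choose (r + 1) with hC
  set l := Real.sqrt (2^(k + 1 +1) * C * Real.log 2) with hl
  have hl' : l = 2 * (√((2 : ℝ) ^ k) * √c0) := by
    rw [hl, ← Real.sqrt_mul (by positivity), hc0]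
    have : (2 : ℝ) ^ (k + 1 + 1) * C * Real.log 2 = 2 ^ 2 * (2 ^ k * (C * Real.log 2)) := by ring
    rw [this, Real.sqrt_mul (by positivity), Real.sqrt_sq (by norm_num)]
  have hl0 : 0 ≤ l := Real.sqrt_nonneg _
  have hl2 : l ^ 2 = 2 * 2 ^ (k + 1) * c0 := by
    rw [hl, Real.sq_sqrt (by positivity), hc0]; ring
  obtain ⟨W, hWc, hW⟩ := exists_W (k + 1) (r + 1)
  set M : ℝ := 2 ^ (2 ^ (k + 1)) with hM
  have hMp : 0 < M := by positivity
  have hWe : (W.card : ℝ) = exp c0 := by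
    rw [hWc, hc0, mul_comm, ← hC]
    push_cast
    rw [Real.exp_mul, Real.exp_log (by norm_num), Real.rpow_natCast]
  have hsm := second_moment W l (M * exp (-((1 + α / 4) * c0))) (M * exp (-c0))
    (M * exp (-(2 * c0 * (1 - α / 4)))) (2 ^ (t * (k + 1 + 1) ^ r)) (by positivity) (α / 4)
    (by positivity) (by positivity)
    (by
      intro g _
      refine le_trans ?_ (single_lower k g l c0 hc hl' h1)
      apply mul_le_mul_of_nonneg_left _ hMp.le
      apply Real.exp_le_exp.mpr
      linarith)
    (fun g _ => single_upper g l c0 hl0 hl2)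
    (fun g _ g' _ h => pair_upper g g' l c0 (α / 4) hl0 hl2 h)
    (by
      intro g hg
      refine le_trans ?_ (bad_card (n := k + 1) (α / 4) (by linarith) (by linarith) r t ht)
      rw [Nat.card_eq_fintype_card, Fintype.card_subtype]
      apply Finset.card_le_card_of_injOn (fun g' x => g x + g' x)
      · intro g' hg'
        simp only [Finset.coe_filter, Finset.mem_univ, true_and, Set.mem_ofPred_eq] at hg' ⊢
        refine ⟨DD_add _ _ _ (hW g hg).2 (hW g' hg'.1).2, ?_⟩
        simp only [sg_add]
        exact hg'.2
      · intro a _ b _ hab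
        funext x
        have := congrFun hab x
        simpa using this)
    (by rw [hWc]; positivity)
  have hbe : ((2 ^ (t * (k + 1 + 1) ^ r) : ℕ) : ℝ) ≤ exp (α / 2 * c0) := by
    push_cast
    rw [← Real.rpow_natCast, Real.rpow_def_of_pos (by norm_num)]
    apply Real.exp_le_exp.mpr
    rw [hc0]
    push_cast at h3 ⊢
    nlinarith
  set E := Finset.univ.filter (fun f : BF (k + 1) => ∃ g ∈ W, l ≤ cor f g) with hE
  have hEle : (E.card : ℝ) ≤ (Nat.card {g : BF (k + 1) | l ≤
              (2^(k + 1) : ℝ) - 2 * nonlin (r + 1) g} : ℝ) := by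
    rw [Nat.card_eq_fintype_card, Fintype.card_subtype]
    apply Nat.cast_le.mpr
    apply Finset.card_le_card
    intro f hf
    simp only [hE, Finset.mem_filter, Finset.mem_univ, true_and, Set.mem_ofPred_eq] at hf ⊢
    obtain ⟨g, hg, hfg⟩ := hf
    rw [cor_eq] at hfg
    have : nonlin (r + 1) f ≤ hdist f g := Nat.sInf_le ⟨g, (hW g hg).1, rfl⟩
    have : (nonlin (r + 1) f : ℝ) ≤ hdist f g := by exact_mod_cast this
    linarith
  rw [hWe] at hsm
  have hR : ((2 ^ (t * (k + 1 + 1) ^ r) : ℕ) : ℝ) * (M * exp (-c0)) +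
      exp c0 * (M * exp (-(2 * c0 * (1 - α / 4)))) ≤ 2 * (M * exp (α / 2 * c0 - c0)) := by
    have e1 : exp c0 * (M * exp (-(2 * c0 * (1 - α / 4)))) = M * exp (α / 2 * c0 - c0) := by
      rw [mul_left_comm, ← Real.exp_add]; ring_nf
    have e2 : ((2 ^ (t * (k + 1 + 1) ^ r) : ℕ) : ℝ) * (M * exp (-c0)) ≤
        exp (α / 2 * c0) * (M * exp (-c0)) := by gcongr
    have e3 : exp (α / 2 * c0) * (M * exp (-c0)) = M * exp (α / 2 * c0 - c0) := by
      rw [mul_left_comm, ← Real.exp_add]; ring_nf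
    linarith
  have hL : exp c0 * (M * exp (-((1 + α / 4) * c0))) ^ 2 =
      M * exp (α / 2 * c0 - c0) * (M * exp (- (α * c0))) := by
    have : M * exp (α / 2 * c0 - c0) * (M * exp (- (α * c0))) =
      M ^ 2 * (exp (α / 2 * c0 - c0) * exp (- (α * c0))) := by ring
    rw [this, mul_pow, mul_left_comm, ← Real.exp_add, ← Real.exp_nat_mul, ← Real.exp_add]
    congr 2
    push_cast
    ring
  have hfin : M * exp (α / 2 * c0 - c0) * (M * exp (- (α * c0))) ≤
      M * exp (α / 2 * c0 - c0) * (2 * E.card) := by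
    rw [← hL]
    refine hsm.trans ((mul_le_mul_of_nonneg_left hR (by positivity)).trans (le_of_eq ?_))
    ring
  have hfin2 := le_of_mul_le_mul_left hfin (by positivity)
  have h4a : (4 : ℝ) ^ (α * (C : ℝ)) = exp (2 * (α * c0)) := by
    rw [Real.rpow_def_of_pos (by norm_num), hc0]
    have : (4 : ℝ) = 2 ^ 2 := by norm_num
    rw [this, Real.log_pow]
    congr 1
    push_cast
    ring
  rw [h4a, le_div_iff₀ hMp, one_div, ← Real.exp_neg]
  refine le_trans ?_ hEle
  have e5 : exp (-(2 * (α * c0))) = exp (-(α * c0)) * exp (-(α * c0)) := by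
    rw [← Real.exp_add]; ring_nf
  have e6 : exp (-(α * c0)) ≤ 1 / 2 := by
    have : (1 / 2 : ℝ) = exp (-Real.log 2) := by
      rw [Real.exp_neg, Real.exp_log (by norm_num), one_div]
    rw [this]
    apply Real.exp_le_exp.mpr
    linarith
  have e7 : 0 < exp (-(α * c0)) := Real.exp_pos _
  have e8 : exp (-(α * c0)) * exp (-(α * c0)) * M ≤ 1 / 2 * exp (-(α * c0)) * M := by gcongr
  rw [e5]
  linarith

lemma choose_ge (n r : ℕ) (h : 2 * r ≤ n) :
    ((n : ℝ) + 1) ^ r / (2 ^ r * (r.factorial : ℝ)) ≤ (n.choose r : ℝ) := by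
  refine le_trans ?_ (Nat.pow_le_choose r n)
  rw [← div_div, ← div_pow]
  gcongr
  rw [Nat.cast_sub (by omega)]
  have : 2 * (r : ℝ) ≤ n := by exact_mod_cast h
  push_cast
  linarith

theorem stmt11 (r : ℕ) (hr : 1 ≤ r) (α : ℝ) (hα0 : 0 < α) (hα1 : α < 1) :
    ∀ᶠ n : ℕ in atTop,
      (1:ℝ) / (4:ℝ) ^ (α * (n.choose r : ℝ)) ≤
        (Nat.card {g : BF n |
            Real.sqrt (2^(n+1) * (n.choose r) * Real.log 2) ≤ (2^n : ℝ) - 2 * nonlin r g} : ℝ)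
          / 2^(2^n) := by
  obtain ⟨r, rfl⟩ : ∃ s, r = s + 1 := ⟨r - 1, by omega⟩
  have hlog : 0 < Real.log 2 := Real.log_pos (by norm_num)
  have hρ1 := rho_lt_one (α / 4) (by linarith) (by linarith)
  have hρ0 : 0 ≤ cosh (α / 4) - α / 4 * sinh (α / 4) := by
    have e1 := Real.sinh_lt_cosh (α / 4)
    have e2 : 0 ≤ sinh (α / 4) := Real.sinh_nonneg_iff.mpr (by linarith)
    nlinarith
  obtain ⟨t, ht⟩ := exists_pow_lt_of_lt_one (show (0 : ℝ) < 1 / 2 ^ (r + 1 + 1) by positivity) hρ1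
  -- a constant for the lower bound of the binomial coefficient
  set D : ℝ := 2 ^ (r + 1) * ((r + 1).factorial : ℝ) with hD
  have hDp : 0 < D := by positivity
  have hn : Tendsto (fun n : ℕ => (n : ℝ)) atTop atTop := tendsto_natCast_atTop_atTop
  have hge : ∀ᶠ n : ℕ in atTop, ((n : ℝ) + 1) ^ r * ((n : ℝ) + 1) / D ≤ (n.choose (r + 1) : ℝ) := by
    filter_upwards [eventually_ge_atTop (2 * (r + 1))] with n hn
    have := choose_ge n (r + 1) hn
    rwa [pow_succ] at this
  have hC : Tendsto (fun n : ℕ => (n.choose (r + 1) : ℝ)) atTop atTop := by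
    refine tendsto_atTop_mono' atTop ?_ (hn.atTop_div_const hDp)
    filter_upwards [hge] with n hn
    refine le_trans ?_ hn
    gcongr
    have h0 : (0 : ℝ) ≤ n := by positivity
    have : (1 : ℝ) ≤ ((n : ℝ) + 1) ^ r := one_le_pow₀ (by linarith)
    nlinarith
  have hc0 : Tendsto (fun n : ℕ => (n.choose (r + 1) : ℝ) * Real.log 2) atTop atTop :=
    hC.atTop_mul_const hlog
  have hs : Tendsto (fun n : ℕ => √((n.choose (r + 1) : ℝ) * Real.log 2)) atTop atTop :=
    Real.tendsto_sqrt_atTop.comp hc0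
  have hexp := tendsto_pow_const_div_const_pow_of_one_lt (6 * (r + 1)) (show (1 : ℝ) < 2 by norm_num)
  have hexp' := hexp.eventually (gt_mem_nhds (show (0 : ℝ) < 1 / 2 ^ 19 by positivity))
  filter_upwards [hge, hs.eventually_ge_atTop (48 / α), hc0.eventually_ge_atTop (88 / α), hexp',
    hn.eventually_ge_atTop (2 * D * t / α), eventually_ge_atTop 1] with n h1 h2 h3 h4 h5 h6
  obtain ⟨k, rfl⟩ : ∃ s, n = s + 1 := ⟨n - 1, by omega⟩
  set c0 := ((k + 1).choose (r + 1) : ℝ) * Real.log 2 with hc0def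
  have hc0n : 0 ≤ c0 := by positivity
  have hss : √c0 ^ 2 = c0 := Real.sq_sqrt hc0n
  rw [div_le_iff₀ hα0] at h2 h3 h5
  refine main_finite k r t α c0 hα0 hα1 ht hc0def ?_ ?_ ?_ ?_
  · set N : ℝ := ((k + 1 : ℕ) : ℝ) ^ (r + 1) with hN
    have hN1 : 1 ≤ N := one_le_pow₀ (by exact_mod_cast h6)
    have hcN : c0 ≤ N := by
      have e1 : ((k + 1).choose (r + 1) : ℝ) ≤ N := by
        rw [hN]; exact_mod_cast Nat.choose_le_pow (k + 1) (r + 1)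
      have e2 : Real.log 2 ≤ 1 := by
        have := Real.log_two_lt_d9; linarith
      calc c0 ≤ N * 1 := by rw [hc0def]; gcongr
        _ = N := mul_one _
    have hsN : √c0 ≤ N := by
      rw [Real.sqrt_le_left (by linarith)]
      nlinarith
    apply Real.le_sqrt_of_sq_le
    have hb : (8 * (√c0 + 3) ^ 3) ^ 2 ≤ (8 * (4 * N) ^ 3) ^ 2 := by
      have := Real.sqrt_nonneg c0
      gcongr
      linarith
    refine hb.trans ?_
    rw [div_lt_div_iff₀ (by positivity) (by positivity)] at h4
    have hN6 : ((k + 1 : ℕ) : ℝ) ^ (6 * (r + 1)) = N ^ 6 := by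
      rw [hN, ← pow_mul, mul_comm]
    rw [hN6, pow_succ 2 k] at h4
    nlinarith
  · nlinarith
  · rw [div_le_iff₀ hDp] at h1
    have hp : (0 : ℝ) ≤ (((k + 1 : ℕ) : ℝ) + 1) ^ r := by positivity
    have e : 2 * D * t ≤ (((k + 1 : ℕ) : ℝ) + 1) * α := by nlinarith
    have e2 : D * (t * (((k + 1 : ℕ) : ℝ) + 1) ^ r) ≤ D * (α / 2 * ((k + 1).choose (r + 1) : ℝ)) := by
      have := mul_le_mul_of_nonneg_left e hp
      nlinarith
    exact le_of_mul_le_mul_left e2 hDp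
  · have := Real.log_two_lt_d9
    linarith
end
end
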